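/- arXiv:1705.08592 — 5 statements merged into one kernel-verified Lean document; each statement's English description precedes it below -/
import Mathlib

section
/- Let k ≥ 3 be an integer and let G be a finite simple graph. If for every subset X ⊆ V(G) we have ∑_{0≤j≤k−1} c_{2j+1}(G−X) ≤ (5/(6k²))·|X|, then G has a {P₂, P_{2k+1}}-factor. -/
open SimpleGraph

/-- The number of connected components of `G - X` having exactly `j` vertices. -/
noncomputable def cComp {V : Type*} (G : SimpleGraph V) (X : Set V) (j : ℕ) : ℕ :=
  Nat.card {C : (G.induce Xᶜ).ConnectedComponent // Nat.card C.supp = j}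

/-- `F` is a `{P₂, P_{2k+1}}`-factor of `G` : a spanning subgraph each of whose connected
components is isomorphic to `P₂` or `P_{2k+1}`. -/
def IsP2P2k1Factor {V : Type*} (G : SimpleGraph V) (k : ℕ) (F : SimpleGraph V) : Prop :=
  F ≤ G ∧ ∀ C : F.ConnectedComponent,
    Nonempty ((F.induce C.supp) ≃g pathGraph 2) ∨
    Nonempty ((F.induce C.supp) ≃g pathGraph (2 * k + 1))

/-! ### Matchings in bipartite relations -/

/-- Hall's marriage theorem for a finite set of indices. -/
theorem Finset.exists_injOn_of_card_le_biUnion {ι α : Type*} [DecidableEq α] [Nonempty α]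
    (S : Finset ι) (t : ι → Finset α) (h : ∀ T ⊆ S, T.card ≤ (T.biUnion t).card) :
    ∃ f : ι → α, Set.InjOn f S ∧ ∀ x ∈ S, f x ∈ t x := by
  classical
  obtain ⟨f, hf, hft⟩ := (Finset.all_card_le_biUnion_card_iff_exists_injective
    (fun x : S => t x)).1 fun T => by
      have := h (T.map (Function.Embedding.subtype _)) (by
        intro x hx
        obtain ⟨y, -, rfl⟩ := Finset.mem_map.1 hx
        exact y.2)
      rw [Finset.card_map] at this
      refine this.trans (Finset.card_le_card ?_)
      intro a ha
      obtain ⟨x, hx, hax⟩ := Finset.mem_biUnion.1 ha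
      obtain ⟨y, hy, rfl⟩ := Finset.mem_map.1 hx
      exact Finset.mem_biUnion.2 ⟨y, hy, hax⟩
  refine ⟨fun x => if hx : x ∈ S then f ⟨x, hx⟩ else Classical.arbitrary α, ?_, ?_⟩
  · intro x hx y hy hxy
    have hx' : x ∈ S := hx
    have hy' : y ∈ S := hy
    simp only [hx', hy', dif_pos] at hxy
    exact congrArg Subtype.val (hf hxy)
  · intro x hx
    simp only [hx, dif_pos]
    exact hft ⟨x, hx⟩

/-- The elements of `β` reachable from elements of `B` missed by `f` on `S`, by alternating
between `g` and `f`. -/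
inductive AlternatelyReachable {α β : Type*} (S : Set α) (B : Set β) (f : α → β) (g : β → α) :
    β → Prop
  | base {b : β} : b ∈ B → b ∉ f '' S → AlternatelyReachable S B f g b
  | step {b : β} : b ∈ B → AlternatelyReachable S B f g b → AlternatelyReachable S B f g (f (g b))

/-- The Mendelsohn–Dulmage theorem: if a relation has a matching `f` covering `S` and a matching
`g` covering `B`, then it has one covering both. -/
theorem exists_injOn_subset_image {α β : Type*} {S : Set α} {B : Set β} {f : α → β} {g : β → α}
    {r : α → β → Prop} (hf : Set.InjOn f S) (hg : Set.InjOn g B) (hgS : ∀ b ∈ B, g b ∈ S)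
    (hrf : ∀ s ∈ S, r s (f s)) (hrg : ∀ b ∈ B, r (g b) b) :
    ∃ h : α → β, Set.InjOn h S ∧ (∀ s ∈ S, r s (h s)) ∧ B ⊆ h '' S := by
  classical
  let P : α → β → Prop := fun s b => b ∈ B ∧ AlternatelyReachable S B f g b ∧ g b = s
  let h : α → β := fun s => if hs : ∃ b, P s b then hs.choose else f s
  have h_pos : ∀ b ∈ B, AlternatelyReachable S B f g b → h (g b) = b := by
    intro b hb hR
    have hs : ∃ c, P (g b) c := ⟨b, hb, hR, rfl⟩
    have hc := hs.choose_spec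
    simp only [h, dif_pos hs]
    exact hg hc.1 hb hc.2.2
  have h_neg : ∀ s, (¬ ∃ b, P s b) → h s = f s := fun s hs => by simp only [h, dif_neg hs]
  have key : ∀ s ∈ S, ∀ s' ∈ S, (∃ b, P s b) → (¬ ∃ b, P s' b) → h s ≠ h s' := by
    rintro s - s' hs' ⟨b, hb, hR, rfl⟩ hn heq
    rw [h_pos b hb hR, h_neg s' hn] at heq
    cases hR with
    | base _ hnot => exact hnot ⟨s', hs', heq.symm⟩
    | step hc hRc => exact hn ⟨_, hc, hRc, hf (hgS _ hc) hs' heq⟩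
  refine ⟨h, ?_, ?_, ?_⟩
  · intro s hs s' hs' heq
    by_cases h1 : ∃ b, P s b <;> by_cases h2 : ∃ b, P s' b
    · obtain ⟨b, hb, hR, rfl⟩ := h1
      obtain ⟨b', hb', hR', rfl⟩ := h2
      rw [h_pos b hb hR, h_pos b' hb' hR'] at heq
      rw [heq]
    · exact absurd heq (key s hs s' hs' h1 h2)
    · exact absurd heq.symm (key s' hs' s hs h2 h1)
    · rw [h_neg s h1, h_neg s' h2] at heq
      exact hf hs hs' heq
  · intro s hs
    by_cases h1 : ∃ b, P s b
    · obtain ⟨b, hb, hR, rfl⟩ := h1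
      rw [h_pos b hb hR]
      exact hrg b hb
    · rw [h_neg s h1]
      exact hrf s hs
  · intro b hb
    by_cases hR : AlternatelyReachable S B f g b
    · exact ⟨g b, hgS b hb, h_pos b hb hR⟩
    · obtain ⟨s, hs, rfl⟩ : b ∈ f '' S := by
        by_contra hn
        exact hR (.base hb hn)
      refine ⟨s, hs, h_neg s ?_⟩
      rintro ⟨c, hc, hRc, rfl⟩
      exact hR (.step hc hRc)

/-! ### Tilings by paths -/

/-- `PathTiled G N A` : the finite set `A` is a disjoint union of vertex sets of paths of `G`
whose orders belong to `N`. -/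
inductive PathTiled {V : Type*} [DecidableEq V] (G : SimpleGraph V) (N : Set ℕ) : Finset V → Prop
  | empty : PathTiled G N ∅
  | union {A : Finset V} (l : List V) : l.IsChain G.Adj → l.Nodup → l.length ∈ N →
      Disjoint l.toFinset A → PathTiled G N A → PathTiled G N (l.toFinset ∪ A)

namespace PathTiled

variable {V : Type*} [DecidableEq V] {G : SimpleGraph V} {N N' : Set ℕ} {A B : Finset V}

theorem mono (hN : N ⊆ N') (hA : PathTiled G N A) : PathTiled G N' A := by
  induction hA with
  | empty => exact .empty
  | union l h1 h2 h3 h4 _ ih => exact .union l h1 h2 (hN h3) h4 ih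

theorem disjUnion (hA : PathTiled G N A) (hB : PathTiled G N B) (hAB : Disjoint A B) :
    PathTiled G N (A ∪ B) := by
  induction hA with
  | empty => simpa using hB
  | union l h1 h2 h3 h4 _ ih =>
    rw [Finset.disjoint_union_left] at hAB
    rw [Finset.union_assoc]
    exact .union l h1 h2 h3 (Finset.disjoint_union_right.2 ⟨h4, hAB.1⟩) (ih hAB.2)

theorem path {l : List V} (h1 : l.IsChain G.Adj) (h2 : l.Nodup) (h3 : l.length ∈ N) :
    PathTiled G N l.toFinset := by
  simpa using PathTiled.union l h1 h2 h3 (Finset.disjoint_empty_right _) .empty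

theorem pair (hN : 2 ∈ N) {x y : V} (h : G.Adj x y) : PathTiled G N {x, y} := by
  simpa using PathTiled.path (G := G) (N := N) (l := [x, y]) (by simpa using h)
    (by simpa using h.ne) (by simpa using hN)

theorem biUnion {ι : Type*} (s : Finset ι) (t : ι → Finset V)
    (hd : (s : Set ι).PairwiseDisjoint t) (ht : ∀ i ∈ s, PathTiled G N (t i)) :
    PathTiled G N (s.biUnion t) := by
  classical
  induction s using Finset.induction_on with
  | empty => simpa using PathTiled.empty
  | insert i s hi ih =>
    rw [Finset.biUnion_insert]
    refine (ht i (Finset.mem_insert_self i s)).disjUnion (ih ?_ ?_) ?_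
    · exact hd.subset (by simp)
    · exact fun j hj => ht j (Finset.mem_insert_of_mem hj)
    · rw [Finset.disjoint_biUnion_right]
      intro j hj
      exact hd (by simp) (by simp [hj]) (by rintro rfl; exact hi hj)

/-- In a perfectly matched set, every vertex can be removed together with its partner. -/
theorem exists_partner (hA : PathTiled G {2} A) {a : V} (ha : a ∈ A) :
    ∃ b ∈ A, G.Adj a b ∧ PathTiled G {2} (A \ {a, b}) := by
  induction hA with
  | empty => simp at ha
  | @union A l h1 h2 h3 h4 hA ih =>
    obtain ⟨x, y, rfl⟩ := List.length_eq_two.1 h3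
    have hxy : G.Adj x y := by simpa using h1
    have hx : x ∉ A := Finset.disjoint_left.1 h4 (by simp)
    have hy : y ∉ A := Finset.disjoint_left.1 h4 (by simp)
    have hdel : ([x, y].toFinset ∪ A) \ {x, y} = A := by
      ext z
      simp only [List.toFinset_cons, List.toFinset_nil, Finset.mem_sdiff, Finset.mem_union,
        Finset.mem_insert, Finset.mem_singleton, Finset.notMem_empty]
      grind
    by_cases hax : a = x
    · subst hax
      exact ⟨y, by simp, hxy, by rwa [hdel]⟩
    by_cases hay : a = y
    · subst hay
      exact ⟨x, by simp, hxy.symm, by rwa [Finset.pair_comm, hdel]⟩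
    have haA : a ∈ A := by simpa [hax, hay] using ha
    obtain ⟨b, hb, hab, ht⟩ := ih haA
    refine ⟨b, by simp [hb], hab, ?_⟩
    have : ([x, y].toFinset ∪ A) \ {a, b} = [x, y].toFinset ∪ (A \ {a, b}) := by
      ext z
      simp only [List.toFinset_cons, List.toFinset_nil, Finset.mem_sdiff, Finset.mem_union,
        Finset.mem_insert, Finset.mem_singleton, Finset.notMem_empty]
      grind
    rw [this]
    exact .union _ h1 h2 h3 (h4.mono_right Finset.sdiff_subset) ht

/-- A tiling by paths is realised by a subgraph in which the tiles are closed under adjacency and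
induce paths. -/
theorem exists_subgraph (hA : PathTiled G N A) :
    ∃ F : SimpleGraph V, F ≤ G ∧ (∀ x y, F.Adj x y → x ∈ A) ∧
      ∀ v ∈ A, ∃ P : Set V, v ∈ P ∧ P ⊆ A ∧ (∀ x ∈ P, ∀ y, F.Adj x y → y ∈ P) ∧
        ∃ n ∈ N, Nonempty (F.induce P ≃g pathGraph n) := by
  induction hA with
  | empty => exact ⟨⊥, bot_le, by simp, by simp⟩
  | @union A l h1 h2 h3 h4 hA ih =>
    obtain ⟨F, hFG, hFA, hF⟩ := ih
    let e : Fin l.length ↪ V := ⟨l.get, List.nodup_iff_injective_get.1 h2⟩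
    have he : ∀ i, e i ∈ l := fun i => List.get_mem l i
    let L : SimpleGraph V := (pathGraph l.length).map e
    have hL : ∀ x y, L.Adj x y → x ∈ l := by
      rintro x y ⟨-, i, j, -, rfl, rfl⟩
      exact he i
    have hlA : ∀ x ∈ l, x ∉ A := fun x hx => Finset.disjoint_left.1 h4 (by simpa using hx)
    refine ⟨F ⊔ L, sup_le hFG ?_, ?_, ?_⟩
    · rintro x y ⟨-, i, j, hij, rfl, rfl⟩
      rw [List.isChain_iff_getElem] at h1
      rw [pathGraph_adj] at hij
      rcases hij with hij | hij
      · have := h1 i (by omega)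
        simp only [hij] at this
        exact this
      · have := h1 j (by omega)
        simp only [hij] at this
        exact this.symm
    · rintro x y (h | h)
      · simp [hFA x y h]
      · simp [hL x y h]
    · intro v hv
      by_cases hvl : v ∈ l
      · refine ⟨Set.range e, ?_, ?_, ?_, l.length, h3, ?_⟩
        · obtain ⟨i, hi⟩ := List.get_of_mem hvl
          exact ⟨i, hi⟩
        · rintro x ⟨i, rfl⟩
          simp [he i]
        · rintro x ⟨i, rfl⟩ y (h | h)
          · exact absurd (hFA _ _ h) (hlA _ (he i))
          · obtain ⟨-, i', j, -, -, rfl⟩ := h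
            exact ⟨j, rfl⟩
        · refine ⟨(RelIso.symm ⟨Equiv.ofInjective e e.injective, ?_⟩)⟩
          intro i j
          simp only [Equiv.ofInjective_apply, comap_adj, sup_adj, Function.Embedding.subtype_apply]
          constructor
          · rintro (h | h)
            · exact absurd (hFA _ _ h) (hlA _ (he i))
            · exact (SimpleGraph.map_adj_apply).1 h
          · exact fun h => Or.inr ((SimpleGraph.map_adj_apply).2 h)
      · have hvA : v ∈ A := by simpa [hvl] using hv
        obtain ⟨P, hvP, hPA, hPc, n, hn, ⟨φ⟩⟩ := hF v hvA
        refine ⟨P, hvP, fun x hx => by simp [Finset.mem_coe.1 (hPA hx)], ?_, n, hn, ?_⟩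
        · rintro x hx y (h | h)
          · exact hPc x hx y h
          · exact absurd (hPA hx) (hlA _ (hL _ _ h))
        · have : (F ⊔ L).induce P = F.induce P := by
            ext x y
            simp only [comap_adj, sup_adj, Function.Embedding.subtype_apply, or_iff_left_iff_imp]
            exact fun h => absurd (hPA x.2) (hlA _ (hL _ _ h))
          exact ⟨this ▸ φ⟩

/-- A tiling of the whole vertex set gives a path-factor. -/
theorem isP2P2k1Factor [Fintype V] {k : ℕ} (h : PathTiled G {2, 2 * k + 1} Finset.univ) :
    ∃ F : SimpleGraph V, IsP2P2k1Factor G k F := by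
  obtain ⟨F, hFG, -, hF⟩ := h.exists_subgraph
  refine ⟨F, hFG, fun C => ?_⟩
  induction C using ConnectedComponent.ind with
  | _ v =>
  obtain ⟨P, hvP, -, hPc, n, hn, ⟨φ⟩⟩ := hF v (Finset.mem_univ v)
  have hconn : (pathGraph n).Preconnected := by
    obtain rfl | rfl := hn
    · exact (pathGraph_connected 1).preconnected
    · exact (pathGraph_connected (2 * k)).preconnected
  have hP : (F.connectedComponentMk v).supp = P := by
    ext x
    rw [ConnectedComponent.mem_supp_iff, ConnectedComponent.eq]
    constructor
    · intro hx
      obtain ⟨w⟩ := hx.symm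
      clear hx
      induction w with
      | nil => exact hvP
      | cons hadj _ ih => exact ih (hPc _ hvP _ hadj)
    · intro hx
      have hr : (F.induce P).Reachable ⟨x, hx⟩ ⟨v, hvP⟩ := by
        rw [← φ.reachable_iff]
        exact hconn _ _
      exact hr.map (Embedding.induce P).toHom
  rw [hP]
  obtain rfl | rfl := hn
  · exact Or.inl ⟨φ⟩
  · exact Or.inr ⟨φ⟩

end PathTiled

/-! ### Barriers -/

/-- `𝒞` is a family of disjoint odd sets of vertices of `A`, each of which is separated by `S` from
the rest of `A`. -/
structure IsBarrier {V : Type*} [DecidableEq V] (G : SimpleGraph V) (A S : Finset V)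
    (𝒞 : Finset (Finset V)) : Prop where
  subset : S ⊆ A
  subset_sdiff : ∀ C ∈ 𝒞, C ⊆ A \ S
  odd : ∀ C ∈ 𝒞, Odd C.card
  disjoint : ∀ C ∈ 𝒞, ∀ D ∈ 𝒞, C ≠ D → Disjoint C D
  closed : ∀ C ∈ 𝒞, ∀ x ∈ C, ∀ y ∈ A, G.Adj x y → y ∈ C ∨ y ∈ S

/-- A barrier of maximum deficiency `#𝒞 - #S` and, among those, with `#S` maximum. -/
structure IsMaxBarrier {V : Type*} [DecidableEq V] (G : SimpleGraph V) (A S : Finset V)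
    (𝒞 : Finset (Finset V)) : Prop extends IsBarrier G A S 𝒞 where
  card_le : ∀ S' 𝒞', IsBarrier G A S' 𝒞' → 𝒞'.card + S.card ≤ 𝒞.card + S'.card
  card_le' : ∀ S' 𝒞', IsBarrier G A S' 𝒞' → 𝒞'.card + S.card = 𝒞.card + S'.card →
    S'.card ≤ S.card

section Barrier

variable {V : Type*} [DecidableEq V] {G : SimpleGraph V} {A S : Finset V} {𝒞 : Finset (Finset V)}

theorem exists_isMaxBarrier [Fintype V] (G : SimpleGraph V) (A : Finset V) :
    ∃ S 𝒞, IsMaxBarrier G A S 𝒞 := by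
  classical
  let f : Finset V × Finset (Finset V) → ℤ ×ₗ ℤ :=
    fun p => toLex ((p.2.card : ℤ) - p.1.card, (p.1.card : ℤ))
  obtain ⟨⟨S, 𝒞⟩, hmem, hmax⟩ := Finset.exists_max_image
    (Finset.univ.filter fun p : Finset V × Finset (Finset V) => IsBarrier G A p.1 p.2) f
    ⟨(∅, ∅), by
      rw [Finset.mem_filter]
      exact ⟨Finset.mem_univ _, by simp, by simp, by simp, by simp, by simp⟩⟩
  rw [Finset.mem_filter] at hmem
  have hle : ∀ S' 𝒞', IsBarrier G A S' 𝒞' →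
      (𝒞'.card : ℤ) - S'.card < 𝒞.card - S.card ∨
        (𝒞'.card : ℤ) - S'.card = 𝒞.card - S.card ∧ (S'.card : ℤ) ≤ S.card := by
    intro S' 𝒞' h
    have := hmax (S', 𝒞') (Finset.mem_filter.2 ⟨Finset.mem_univ _, h⟩)
    rwa [Prod.Lex.toLex_le_toLex] at this
  refine ⟨S, 𝒞, hmem.2, fun S' 𝒞' h => ?_, fun S' 𝒞' h heq => ?_⟩
  · have := hle S' 𝒞' h
    omega
  · have := hle S' 𝒞' h
    omega

namespace IsBarrier

theorem nonempty (hb : IsBarrier G A S 𝒞) {C : Finset V} (hC : C ∈ 𝒞) : C.Nonempty :=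
  Finset.card_pos.1 (hb.odd C hC).pos

/-- The part of `A` outside the barrier, if odd, can be added to the family. -/
theorem insert_rest (hb : IsBarrier G A S 𝒞) (hodd : Odd (A \ (S ∪ 𝒞.biUnion id)).card) :
    A \ (S ∪ 𝒞.biUnion id) ∉ 𝒞 ∧ IsBarrier G A S (insert (A \ (S ∪ 𝒞.biUnion id)) 𝒞) := by
  set R := A \ (S ∪ 𝒞.biUnion id) with hR
  have hRC : ∀ C ∈ 𝒞, Disjoint R C := by
    intro C hC
    rw [Finset.disjoint_left]
    intro x hx hxC
    rw [hR, Finset.mem_sdiff, Finset.mem_union, Finset.mem_biUnion] at hx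
    exact hx.2 (Or.inr ⟨C, hC, hxC⟩)
  have hRA : R ⊆ A \ S := Finset.sdiff_subset_sdiff le_rfl Finset.subset_union_left
  refine ⟨fun h => ?_, hb.subset, ?_, ?_, ?_, ?_⟩
  · have := hRC R h
    rw [disjoint_self, Finset.bot_eq_empty] at this
    rw [this] at hodd
    simp at hodd
  · intro C hC
    rcases Finset.mem_insert.1 hC with rfl | hC
    · exact hRA
    · exact hb.subset_sdiff C hC
  · intro C hC
    rcases Finset.mem_insert.1 hC with rfl | hC
    · exact hodd
    · exact hb.odd C hC
  · intro C hC D hD hne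
    rcases Finset.mem_insert.1 hC with rfl | hC <;> rcases Finset.mem_insert.1 hD with rfl | hD
    · exact absurd rfl hne
    · exact hRC D hD
    · exact (hRC C hC).symm
    · exact hb.disjoint C hC D hD hne
  · intro C hC x hx y hy hxy
    rcases Finset.mem_insert.1 hC with rfl | hC
    · by_contra! hcon
      have : y ∈ 𝒞.biUnion id := by
        by_contra hn
        exact hcon.1 (Finset.mem_sdiff.2 ⟨hy, by simp only [Finset.mem_union]; tauto⟩)
      obtain ⟨C, hC, hyC⟩ := Finset.mem_biUnion.1 this
      rcases hb.closed C hC y hyC x (Finset.mem_sdiff.1 (hRA hx)).1 hxy.symm with h | h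
      · exact Finset.disjoint_left.1 (hRC C hC) hx h
      · exact (Finset.mem_sdiff.1 (hRA hx)).2 h
    · exact hb.closed C hC x hx y hy hxy

theorem insert_vertex (hb : IsBarrier G A S 𝒞) {v : V} (hv : v ∈ A \ (S ∪ 𝒞.biUnion id)) :
    IsBarrier G A (insert v S) 𝒞 := by
  rw [Finset.mem_sdiff, Finset.mem_union, Finset.mem_biUnion] at hv
  refine ⟨Finset.insert_subset hv.1 hb.subset, ?_, hb.odd, hb.disjoint, ?_⟩
  · intro C hC x hx
    have := Finset.mem_sdiff.1 (hb.subset_sdiff C hC hx)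
    rw [Finset.mem_sdiff, Finset.mem_insert, not_or]
    exact ⟨this.1, by rintro rfl; exact hv.2 (Or.inr ⟨C, hC, hx⟩), this.2⟩
  · intro C hC x hx y hy hxy
    rw [Finset.mem_insert]
    have := hb.closed C hC x hx y hy hxy
    tauto

/-- A barrier of `C - v`, where `C` is a member of the family, refines the given barrier. -/
theorem refine_erase (hb : IsBarrier G A S 𝒞) {C : Finset V} (hC : C ∈ 𝒞) {v : V} (hv : v ∈ C)
    {T : Finset V} {𝒟 : Finset (Finset V)} (hd : IsBarrier G (C.erase v) T 𝒟) :
    IsBarrier G A (S ∪ insert v T) (𝒞.erase C ∪ 𝒟) ∧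
      (S ∪ insert v T).card = S.card + T.card + 1 ∧
      (𝒞.erase C ∪ 𝒟).card + 1 = 𝒞.card + 𝒟.card := by
  have hCA := hb.subset_sdiff C hC
  have hTC : insert v T ⊆ C :=
    Finset.insert_subset hv (hd.subset.trans (Finset.erase_subset _ _))
  have hDC : ∀ D ∈ 𝒟, D ⊆ C := fun D hD =>
    (hd.subset_sdiff D hD).trans (Finset.sdiff_subset.trans (Finset.erase_subset _ _))
  have hDT : ∀ D ∈ 𝒟, ∀ x ∈ D, x ≠ v ∧ x ∉ T := fun D hD x hx => by
    have := hd.subset_sdiff D hD hx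
    rw [Finset.mem_sdiff, Finset.mem_erase] at this
    exact ⟨this.1.1, this.2⟩
  have hcross : ∀ C' ∈ 𝒞.erase C, Disjoint C' C := fun C' hC' =>
    hb.disjoint C' (Finset.mem_of_mem_erase hC') C hC (Finset.ne_of_mem_erase hC')
  refine ⟨⟨?_, ?_, ?_, ?_, ?_⟩, ?_, ?_⟩
  · exact Finset.union_subset hb.subset (hTC.trans (hCA.trans Finset.sdiff_subset))
  · intro D hD x hx
    rw [Finset.mem_sdiff, Finset.mem_union, not_or]
    rcases Finset.mem_union.1 hD with hD | hD
    · have := Finset.mem_sdiff.1 (hb.subset_sdiff D (Finset.mem_of_mem_erase hD) hx)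
      exact ⟨this.1, this.2, fun h => Finset.disjoint_left.1 (hcross D hD) hx (hTC h)⟩
    · have := Finset.mem_sdiff.1 (hCA (hDC D hD hx))
      refine ⟨this.1, this.2, ?_⟩
      rw [Finset.mem_insert, not_or]
      exact hDT D hD x hx
  · intro D hD
    rcases Finset.mem_union.1 hD with hD | hD
    · exact hb.odd D (Finset.mem_of_mem_erase hD)
    · exact hd.odd D hD
  · intro D hD D' hD' hne
    rcases Finset.mem_union.1 hD with hD | hD <;> rcases Finset.mem_union.1 hD' with hD' | hD'
    · exact hb.disjoint _ (Finset.mem_of_mem_erase hD) _ (Finset.mem_of_mem_erase hD') hne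
    · exact (hcross D hD).mono_right (hDC D' hD')
    · exact ((hcross D' hD').mono_right (hDC D hD)).symm
    · exact hd.disjoint _ hD _ hD' hne
  · intro D hD x hx y hy hxy
    simp only [Finset.mem_union, Finset.mem_insert]
    rcases Finset.mem_union.1 hD with hD | hD
    · have := hb.closed D (Finset.mem_of_mem_erase hD) x hx y hy hxy
      tauto
    · by_cases hyv : y = v
      · exact Or.inr (Or.inr (Or.inl hyv))
      rcases hb.closed C hC x (hDC D hD hx) y hy hxy with h | h
      · have := hd.closed D hD x hx y (Finset.mem_erase.2 ⟨hyv, h⟩) hxy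
        tauto
      · exact Or.inr (Or.inl h)
  · rw [Finset.card_union_of_disjoint, Finset.card_insert_of_notMem, add_assoc]
    · exact fun h => absurd rfl (Finset.mem_erase.1 (hd.subset h)).1
    · rw [Finset.disjoint_left]
      exact fun x hx hx' => (Finset.mem_sdiff.1 (hCA (hTC hx'))).2 hx
  · rw [Finset.card_union_of_disjoint, Finset.card_erase_of_mem hC]
    · have := Finset.card_pos.2 ⟨C, hC⟩
      omega
    · rw [Finset.disjoint_left]
      intro D hD hD'
      obtain ⟨x, hx⟩ := hd.nonempty hD'
      exact Finset.disjoint_left.1 (hcross D hD) hx (hDC D hD' hx)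

/-- Tilings of the members of a barrier, with one vertex removed from those that are matched to
`S`, can be assembled into a tiling of the whole set. -/
theorem pathTiled {N : Set ℕ} (hb : IsBarrier G A S 𝒞) (hcover : A = S ∪ 𝒞.biUnion id)
    (hN : 2 ∈ N) {h : V → Finset V} (hinj : Set.InjOn h S)
    (hmem : ∀ s ∈ S, h s ∈ 𝒞 ∧ ∃ v ∈ h s, G.Adj s v)
    (herase : ∀ C ∈ 𝒞, ∀ v ∈ C, PathTiled G N (C.erase v))
    (hout : ∀ C ∈ 𝒞, C ∉ h '' S → PathTiled G N C) : PathTiled G N A := by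
  have hSC : ∀ C ∈ 𝒞, ∀ s ∈ S, s ∉ C := fun C hC s hs hsC =>
    (Finset.mem_sdiff.1 (hb.subset_sdiff C hC hsC)).2 hs
  have hA : A = S.biUnion (fun s => insert s (h s)) ∪
      (𝒞.filter fun C => C ∉ S.image h).biUnion id := by
    rw [hcover]
    ext x
    simp only [Finset.mem_union, Finset.mem_biUnion, id, Finset.mem_insert, Finset.mem_filter,
      Finset.mem_image]
    constructor
    · rintro (hx | ⟨C, hC, hx⟩)
      · exact Or.inl ⟨x, hx, Or.inl rfl⟩
      · by_cases hCh : ∃ s ∈ S, h s = C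
        · obtain ⟨s, hs, rfl⟩ := hCh
          exact Or.inl ⟨s, hs, Or.inr hx⟩
        · exact Or.inr ⟨C, ⟨hC, hCh⟩, hx⟩
    · rintro (⟨s, hs, rfl | hx⟩ | ⟨C, ⟨hC, -⟩, hx⟩)
      · exact Or.inl hs
      · exact Or.inr ⟨h s, (hmem s hs).1, hx⟩
      · exact Or.inr ⟨C, hC, hx⟩
  rw [hA]
  refine PathTiled.disjUnion (PathTiled.biUnion _ _ ?_ ?_) (PathTiled.biUnion _ _ ?_ ?_) ?_
  · intro s hs s' hs' hne
    have hs : s ∈ S := hs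
    have hs' : s' ∈ S := hs'
    change Disjoint (insert s (h s)) (insert s' (h s'))
    rw [Finset.disjoint_insert_left, Finset.disjoint_insert_right, Finset.mem_insert, not_or]
    exact ⟨⟨hne, hSC _ (hmem s' hs').1 s hs⟩, hSC _ (hmem s hs).1 s' hs',
      hb.disjoint _ (hmem s hs).1 _ (hmem s' hs').1 fun e => hne (hinj hs hs' e)⟩
  · intro s hs
    obtain ⟨hC, v, hv, hsv⟩ := hmem s hs
    have : insert s (h s) = {s, v} ∪ (h s).erase v := by
      rw [Finset.insert_union, ← Finset.insert_eq, Finset.insert_erase hv]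
    rw [this]
    refine (PathTiled.pair hN hsv).disjUnion (herase _ hC v hv) ?_
    rw [Finset.disjoint_insert_left, Finset.disjoint_singleton_left]
    exact ⟨fun hs' => hSC _ hC s hs (Finset.mem_of_mem_erase hs'), Finset.notMem_erase v _⟩
  · intro C hC D hD hne
    rw [Finset.mem_coe, Finset.mem_filter] at hC hD
    exact hb.disjoint C hC.1 D hD.1 hne
  · intro C hC
    rw [Finset.mem_filter] at hC
    refine hout C hC.1 ?_
    rintro ⟨s, hs, rfl⟩
    exact hC.2 (Finset.mem_image_of_mem h hs)
  · rw [Finset.disjoint_biUnion_left]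
    intro s hs
    rw [Finset.disjoint_biUnion_right]
    intro C hC
    rw [Finset.mem_filter] at hC
    rw [id, Finset.disjoint_insert_left]
    exact ⟨hSC C hC.1 s hs, hb.disjoint _ (hmem s hs).1 C hC.1 fun e =>
      hC.2 (e ▸ Finset.mem_image_of_mem h hs)⟩

end IsBarrier

namespace IsMaxBarrier

theorem cover (hb : IsMaxBarrier G A S 𝒞) : A = S ∪ 𝒞.biUnion id := by
  have hsub : S ∪ 𝒞.biUnion id ⊆ A := by
    refine Finset.union_subset hb.subset (Finset.biUnion_subset.2 fun C hC => ?_)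
    exact (hb.subset_sdiff C hC).trans Finset.sdiff_subset
  have hnot : ∀ S', IsBarrier G A S' 𝒞 → S ⊆ S' → S'.card ≤ S.card + 1 →
      ¬ Odd (A \ (S' ∪ 𝒞.biUnion id)).card := by
    intro S' hb' hSS' hcard hodd
    obtain ⟨hn, hins⟩ := hb'.insert_rest hodd
    have h1 := hb.card_le _ _ hins
    have h2 := hb.card_le' _ _ hins
    rw [Finset.card_insert_of_notMem hn] at h1 h2
    omega
  refine (Finset.sdiff_eq_empty_iff_subset.1 ?_).antisymm hsub
  by_contra hne
  obtain ⟨v, hv⟩ := Finset.nonempty_iff_ne_empty.2 hne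
  have heven := hnot S hb.toIsBarrier le_rfl (by omega)
  have hv' := Finset.mem_sdiff.1 hv
  have hvS : v ∉ S := fun h => hv'.2 (Finset.mem_union_left _ h)
  refine hnot _ (hb.insert_vertex hv) (Finset.subset_insert v S)
    (Finset.card_insert_le v S) ?_
  rw [Finset.insert_union, Finset.sdiff_insert, Finset.card_erase_of_mem hv]
  have := Finset.card_pos.2 ⟨v, hv⟩
  rw [Nat.not_odd_iff_even] at heven
  exact Nat.Even.sub_odd this heven odd_one

/-- Some members of the family can be matched to `S` so as to cover `S`. -/
theorem exists_matching (hb : IsMaxBarrier G A S 𝒞) :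
    ∃ h : V → Finset V, Set.InjOn h S ∧ ∀ s ∈ S, h s ∈ 𝒞 ∧ ∃ v ∈ h s, G.Adj s v := by
  classical
  obtain ⟨h, hinj, hh⟩ := Finset.exists_injOn_of_card_le_biUnion S
    (fun s => 𝒞.filter fun C => ∃ v ∈ C, G.Adj s v) (by
      intro T hT
      set 𝒟 := T.biUnion (fun s => 𝒞.filter fun C => ∃ v ∈ C, G.Adj s v) with h𝒟
      have hsub : 𝒟 ⊆ 𝒞 := Finset.biUnion_subset.2 fun s _ => Finset.filter_subset _ _
      have hbar : IsBarrier G A (S \ T) (𝒞 \ 𝒟) := by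
        refine ⟨Finset.sdiff_subset.trans hb.subset, ?_, ?_, ?_, ?_⟩
        · intro C hC
          exact (hb.subset_sdiff C (Finset.mem_sdiff.1 hC).1).trans
            (Finset.sdiff_subset_sdiff le_rfl Finset.sdiff_subset)
        · exact fun C hC => hb.odd C (Finset.mem_sdiff.1 hC).1
        · exact fun C hC D hD =>
            hb.disjoint C (Finset.mem_sdiff.1 hC).1 D (Finset.mem_sdiff.1 hD).1
        · intro C hC x hx y hy hxy
          obtain ⟨hC, hCD⟩ := Finset.mem_sdiff.1 hC
          refine (hb.closed C hC x hx y hy hxy).imp_right fun hyS => ?_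
          refine Finset.mem_sdiff.2 ⟨hyS, fun hyT => hCD ?_⟩
          exact Finset.mem_biUnion.2 ⟨y, hyT, Finset.mem_filter.2 ⟨hC, x, hx, hxy.symm⟩⟩
      have h1 := hb.card_le _ _ hbar
      have h2 := Finset.card_sdiff_add_card_eq_card hsub
      have h3 := Finset.card_sdiff_add_card_eq_card hT
      omega)
  exact ⟨h, hinj, fun s hs => Finset.mem_filter.1 (hh s hs)⟩

theorem card_le_of_cover (hb : IsMaxBarrier G A S 𝒞) {C : Finset V} (hC : C ∈ 𝒞) {v : V}
    (hv : v ∈ C) {T : Finset V} {𝒟 : Finset (Finset V)} (hd : IsBarrier G (C.erase v) T 𝒟)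
    (hcover : C.erase v = T ∪ 𝒟.biUnion id) : 𝒟.card ≤ T.card := by
  obtain ⟨hr, h1, h2⟩ := hb.refine_erase hC hv hd
  have h3 := hb.card_le _ _ hr
  have h4 := hb.card_le' _ _ hr
  have h5 : (C.erase v).card = T.card + ∑ D ∈ 𝒟, D.card := by
    rw [hcover, Finset.card_union_of_disjoint, Finset.card_biUnion]
    · simp
    · exact fun D hD D' hD' hne => hd.disjoint D hD D' hD' hne
    · rw [Finset.disjoint_biUnion_right]
      intro D hD
      rw [Finset.disjoint_left]
      exact fun x hx hxD => (Finset.mem_sdiff.1 (hd.subset_sdiff D hD hxD)).2 hx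
  have h6 : (∑ D ∈ 𝒟, D.card) % 2 = 𝒟.card % 2 := by
    rw [Finset.sum_nat_mod, Finset.sum_congr rfl fun D hD => Nat.odd_iff.1 (hd.odd D hD)]
    simp
  have h7 := Nat.odd_iff.1 (hb.odd C hC)
  have h8 := Finset.card_erase_add_one hv
  omega

/-- The members of the family of a maximum barrier are factor-critical. -/
theorem pathTiled_erase [Fintype V] (hb : IsMaxBarrier G A S 𝒞) {C : Finset V} (hC : C ∈ 𝒞)
    {v : V} (hv : v ∈ C) : PathTiled G {2} (C.erase v) := by
  induction hn : A.card using Nat.strong_induction_on generalizing A S 𝒞 C v with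
  | _ n ih =>
  obtain ⟨T, 𝒟, hd⟩ := exists_isMaxBarrier G (C.erase v)
  have hlt : (C.erase v).card < n := by
    have h1 := Finset.card_erase_lt_of_mem hv
    have h2 := Finset.card_le_card ((hb.subset_sdiff C hC).trans Finset.sdiff_subset)
    omega
  have hle := hb.card_le_of_cover hC hv hd.toIsBarrier hd.cover
  obtain ⟨h, hinj, hmem⟩ := hd.exists_matching
  refine hd.pathTiled hd.cover rfl hinj hmem
    (fun D hD w hw => ih _ hlt hd hD hw rfl) fun D hD hDh => absurd ?_ hDh
  have himg : T.image h = 𝒟 := by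
    refine Finset.eq_of_subset_of_card_le ?_ ?_
    · exact Finset.image_subset_iff.2 fun s hs => (hmem s hs).1
    · rwa [Finset.card_image_of_injOn hinj]
  rw [← himg] at hD
  simpa using hD

end IsMaxBarrier

end Barrier

/-! ### Alternating paths and isolated vertices -/

/-- If `C - v` is perfectly matched for some `v ∈ C`, then either `C` is tiled by paths of orders
`2` and `2k + 1`, or `C` has a vertex with fewer than `2k - 1` neighbours in `C`. -/
theorem PathTiled.or_exists_card_le {V : Type*} [DecidableEq V] {G : SimpleGraph V}
    [DecidableRel G.Adj] {C : Finset V} {v : V} (hv : v ∈ C) (h : PathTiled G {2} (C.erase v))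
    (k : ℕ) : PathTiled G {2, 2 * k + 1} C ∨ ∃ w ∈ C, (C.filter (G.Adj w)).card + 2 ≤ 2 * k := by
  rw [or_iff_not_imp_right]
  intro hdeg
  push Not at hdeg
  have key : ∀ m ≤ k, ∃ l : List V, l.IsChain G.Adj ∧ l.Nodup ∧ l.length = 2 * m + 1 ∧
      l.toFinset ⊆ C ∧ PathTiled G {2} (C \ l.toFinset) := by
    intro m
    induction m with
    | zero =>
      intro _
      refine ⟨[v], by simp, by simp, by simp, by simpa using hv, ?_⟩
      simpa [Finset.sdiff_singleton_eq_erase] using h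
    | succ m ih =>
      intro hm
      obtain ⟨l, h1, h2, h3, h4, h5⟩ := ih (by omega)
      obtain ⟨w, l', rfl⟩ := List.exists_cons_of_length_eq_add_one h3
      obtain ⟨a, ha, hal⟩ : ∃ a ∈ C.filter (G.Adj w), a ∉ l'.toFinset := by
        by_contra! hcon
        have h6 := Finset.card_le_card (show C.filter (G.Adj w) ⊆ l'.toFinset from hcon)
        have h7 := hdeg w (h4 (by simp))
        have h8 := l'.toFinset_card_le
        rw [List.length_cons] at h3
        omega
      rw [Finset.mem_filter] at ha
      have hal' : a ∉ (w :: l') := by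
        simp only [List.mem_cons, not_or]
        exact ⟨ha.2.ne', by simpa using hal⟩
      obtain ⟨b, hb, hab, h6⟩ := h5.exists_partner
        (Finset.mem_sdiff.2 ⟨ha.1, by simpa using hal'⟩)
      rw [Finset.mem_sdiff, List.mem_toFinset] at hb
      refine ⟨b :: a :: w :: l', ?_, ?_, ?_, ?_, ?_⟩
      · exact (h1.cons_cons ha.2.symm).cons_cons hab.symm
      · refine List.nodup_cons.2 ⟨?_, List.nodup_cons.2 ⟨hal', h2⟩⟩
        rw [List.mem_cons, not_or]
        exact ⟨hab.ne', hb.2⟩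
      · simp only [List.length_cons] at h3 ⊢
        omega
      · rw [List.toFinset_cons, List.toFinset_cons]
        exact Finset.insert_subset hb.1 (Finset.insert_subset ha.1 h4)
      · convert h6 using 1
        ext x
        simp only [List.toFinset_cons, Finset.mem_sdiff, Finset.mem_insert, Finset.mem_singleton]
        tauto
  obtain ⟨l, h1, h2, h3, h4, h5⟩ := key k le_rfl
  have := (PathTiled.path (N := {2, 2 * k + 1}) h1 h2 (by simp [h3])).disjUnion
    (h5.mono (by simp)) Finset.disjoint_sdiff
  rwa [Finset.union_sdiff_of_subset h4] at this

/-- Vertices outside `X` all of whose neighbours lie in `X` are isolated vertices of `G - X`. -/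
theorem card_le_cComp_one {V : Type*} [Finite V] (G : SimpleGraph V) (I : Finset V) (X : Set V)
    (hI : ∀ w ∈ I, w ∉ X) (hadj : ∀ w ∈ I, ∀ y, G.Adj w y → y ∈ X) : I.card ≤ cComp G X 1 := by
  classical
  have hsupp : ∀ w (hw : w ∈ I),
      ((G.induce Xᶜ).connectedComponentMk ⟨w, hI w hw⟩).supp = {⟨w, hI w hw⟩} := by
    intro w hw
    ext y
    rw [ConnectedComponent.mem_supp_iff, ConnectedComponent.eq, Set.mem_singleton_iff]
    constructor
    · rintro ⟨p⟩
      cases p.reverse with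
      | nil => rfl
      | @cons _ u _ h _ => exact absurd (hadj w hw _ h) u.2
    · rintro rfl
      exact Reachable.refl _
  have hcard := Nat.card_le_card_of_injective
    (fun w : I => (⟨(G.induce Xᶜ).connectedComponentMk ⟨w, hI w w.2⟩, by simp [hsupp w w.2]⟩ :
      {C : (G.induce Xᶜ).ConnectedComponent // Nat.card C.supp = 1})) (by
    intro w w' heq
    have h1 := congrArg (fun C => C.1.supp) heq
    simp only [hsupp _ w.2, hsupp _ w'.2, Set.singleton_eq_singleton_iff, Subtype.mk.injEq] at h1
    exact Subtype.ext h1)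
  simpa [cComp] using hcard

/-- If `k ≥ 3` and `∑_{0 ≤ j ≤ k-1} c_{2j+1}(G - X) ≤ (5/(6k²))·|X|` for all `X ⊆ V(G)`,
then `G` has a `{P₂, P_{2k+1}}`-factor. -/
theorem stmt0 {V : Type} [Fintype V] (k : ℕ) (hk : 3 ≤ k) (G : SimpleGraph V)
    (h : ∀ X : Set V,
      (∑ j ∈ Finset.range k, (cComp G X (2 * j + 1) : ℝ)) ≤ (5 / (6 * k ^ 2)) * Nat.card X) :
    ∃ F : SimpleGraph V, IsP2P2k1Factor G k F := by
  classical
  have hiso : ∀ I X : Finset V, (∀ w ∈ I, w ∉ X) → (∀ w ∈ I, ∀ y, G.Adj w y → y ∈ X) →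
      2 * k * I.card ≤ X.card := by
    intro I X hI hadj
    have h1 : (I.card : ℝ) ≤ cComp G X 1 :=
      mod_cast card_le_cComp_one G I X (by simpa using hI) (by simpa using hadj)
    have h2 : (cComp G X 1 : ℝ) ≤ ∑ j ∈ Finset.range k, (cComp G X (2 * j + 1) : ℝ) :=
      Finset.single_le_sum (s := Finset.range k) (f := fun j => (cComp G X (2 * j + 1) : ℝ))
        (a := 0) (fun j _ => Nat.cast_nonneg _) (Finset.mem_range.2 (by omega))
    have h3 := h1.trans (h2.trans (h X))
    have h4 : Nat.card (X : Set V) = X.card := by simp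
    rw [h4, div_mul_eq_mul_div, le_div_iff₀ (by positivity)] at h3
    have h5 : I.card * (6 * k ^ 2) ≤ 5 * X.card := mod_cast h3
    nlinarith only [h5, Nat.mul_le_mul_left (I.card * k) hk, Nat.zero_le (I.card * k)]
  obtain ⟨S, 𝒞, hb⟩ := exists_isMaxBarrier G Finset.univ
  obtain ⟨f, hf, hfS⟩ := hb.exists_matching
  let N : Set ℕ := {2, 2 * k + 1}
  let ℬ : Finset (Finset V) := 𝒞.filter fun C => ¬ PathTiled G N C
  have hlow : ∀ C ∈ ℬ, ∃ w ∈ C, (C.filter (G.Adj w)).card + 2 ≤ 2 * k := by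
    intro C hC
    obtain ⟨hC, hnot⟩ := Finset.mem_filter.1 hC
    obtain ⟨v, hv⟩ := hb.nonempty hC
    exact (PathTiled.or_exists_card_le hv (hb.pathTiled_erase hC hv) k).resolve_left hnot
  obtain hV | hV := isEmpty_or_nonempty V
  · exact ⟨⊥, bot_le, fun C => C.ind fun v => isEmptyElim v⟩
  choose! w hwC hwdeg using hlow
  have hℬ : ∀ C ∈ ℬ, C ∈ 𝒞 := fun C hC => (Finset.mem_filter.1 hC).1
  obtain ⟨g, hg, hgt⟩ := Finset.exists_injOn_of_card_le_biUnion ℬ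
    (fun C => S.filter fun s => ∃ v ∈ C, G.Adj s v) (by
      intro 𝒯 h𝒯
      set S' := 𝒯.biUnion (fun C => S.filter fun s => ∃ v ∈ C, G.Adj s v) with hS'
      set Y := 𝒯.biUnion (fun C => C.filter (G.Adj (w C))) with hY
      have hdisj : ∀ C ∈ 𝒯, ∀ D ∈ 𝒯, ∀ x, x ∈ C → x ∈ D → C = D := by
        intro C hC D hD x hxC hxD
        by_contra hne
        exact Finset.disjoint_left.1
          (hb.disjoint C (hℬ C (h𝒯 hC)) D (hℬ D (h𝒯 hD)) hne) hxC hxD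
      have hcard : (𝒯.image w).card = 𝒯.card := by
        refine Finset.card_image_of_injOn fun C hC D hD heq => ?_
        exact hdisj C hC D hD (w C) (hwC C (h𝒯 hC)) (heq ▸ hwC D (h𝒯 hD))
      have h1 := hiso (𝒯.image w) (S' ∪ Y) (by
        intro x hx
        obtain ⟨C, hC, rfl⟩ := Finset.mem_image.1 hx
        rw [Finset.mem_union, not_or]
        constructor
        · intro hmem
          obtain ⟨D, -, hxD⟩ := Finset.mem_biUnion.1 hmem
          exact (Finset.mem_sdiff.1 (hb.subset_sdiff C (hℬ C (h𝒯 hC)) (hwC C (h𝒯 hC)))).2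
            (Finset.mem_filter.1 hxD).1
        · intro hmem
          obtain ⟨D, hD, hxD⟩ := Finset.mem_biUnion.1 hmem
          rw [Finset.mem_filter] at hxD
          obtain rfl := hdisj C hC D hD (w C) (hwC C (h𝒯 hC)) hxD.1
          exact hxD.2.ne rfl) (by
        intro x hx y hxy
        obtain ⟨C, hC, rfl⟩ := Finset.mem_image.1 hx
        rw [Finset.mem_union]
        rcases hb.closed C (hℬ C (h𝒯 hC)) _ (hwC C (h𝒯 hC)) y (Finset.mem_univ y) hxy with hy | hy
        · exact Or.inr (Finset.mem_biUnion.2 ⟨C, hC, Finset.mem_filter.2 ⟨hy, hxy⟩⟩)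
        · exact Or.inl (Finset.mem_biUnion.2 ⟨C, hC, Finset.mem_filter.2
            ⟨hy, w C, hwC C (h𝒯 hC), hxy.symm⟩⟩))
      have h2 : Y.card ≤ 𝒯.card * (2 * k - 2) := by
        refine Finset.card_biUnion_le_card_mul _ _ _ fun C hC => ?_
        have := hwdeg C (h𝒯 hC)
        omega
      have h3 := Finset.card_union_le S' Y
      have h4 : 𝒯.card * (2 * k - 2) + 𝒯.card * 2 = 2 * k * 𝒯.card := by
        rw [← mul_add, Nat.sub_add_cancel (by omega), mul_comm]
      rw [hcard] at h1
      omega)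
  obtain ⟨e, he, heS, hcov⟩ := exists_injOn_subset_image (S := (S : Set V))
    (B := (ℬ : Set (Finset V))) (r := fun s C => C ∈ 𝒞 ∧ ∃ v ∈ C, G.Adj s v) hf hg
    (fun C hC => (Finset.mem_filter.1 (hgt C hC)).1) hfS
    (fun C hC => ⟨hℬ C hC, (Finset.mem_filter.1 (hgt C hC)).2⟩)
  refine PathTiled.isP2P2k1Factor (hb.pathTiled hb.cover (by simp) he heS
    (fun C hC v hv => (hb.pathTiled_erase hC hv).mono (by simp)) fun C hC hCe => ?_)
  by_contra hnot
  exact hCe (hcov (Finset.mem_coe.2 (Finset.mem_filter.2 ⟨hC, hnot⟩)))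
end

section
/- For every integer k ≥ 29 and every integer N, there exists a finite simple graph G with |V(G)| > N such that G has no {P₂, P_{2k+1}}-factor and yet ∑_{0≤j≤k−1} c_{2j+1}(G−X) ≤ ((32k+141)/(72k−78))·|X| for all X ⊆ V(G). -/
open SimpleGraph

/-- The vertices of the construction are labelled: `inl true` marks the core, `inl false` a
separate clique, `inr (i, true)` the hub of the `i`-th block and `inr (i, false)` its blob. -/
abbrev Label (m : ℕ) := Bool ⊕ (Fin m × Bool)

/-- The labels whose vertices are joined to each other. -/
def LabelsJoined {m : ℕ} : Label m → Label m → Prop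
  | .inl a, .inl b => a = b
  | .inl a, .inr _ => a = true
  | .inr _, .inl b => b = true
  | .inr (i, a), .inr (j, b) => i = j ∨ (a = true ∧ b = true)

theorem LabelsJoined.symm {m : ℕ} {x y : Label m} (h : LabelsJoined x y) : LabelsJoined y x := by
  rcases x with a | ⟨i, a⟩ <;> rcases y with b | ⟨j, b⟩ <;>
    simp only [LabelsJoined] at h ⊢ <;> tauto

theorem labelsJoined_core {m : ℕ} {x : Label m} (hx : x ≠ .inl false) :
    LabelsJoined x (.inl true) := by
  rcases x with (_ | _) | ⟨i, a⟩
  · exact absurd rfl hx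
  · rfl
  · rfl

theorem LabelsJoined.refl {m : ℕ} (x : Label m) : LabelsJoined x x := by
  rcases x with a | ⟨i, a⟩ <;> simp [LabelsJoined]

/-- The number of vertices with a given label: `l` in the core, `M` in the separate clique,
one hub per block, and an even number in each blob. -/
def labelSize (l m r M : ℕ) : Label m → ℕ
  | .inl true => l
  | .inl false => M
  | .inr (_, true) => 1
  | .inr (i, false) => 2 + if i.val = 0 then 2 * r else 0

/-- The vertex type of the construction. -/
abbrev HubVertex (l m r M : ℕ) := Σ x : Label m, Fin (labelSize l m r M x)

/-- The disjoint union of a clique on `M` vertices and the join of a clique on `l` vertices with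
the graph obtained from a clique of `m` hubs by attaching an even clique to each hub. -/
def hubGraph (l m r M : ℕ) : SimpleGraph (HubVertex l m r M) where
  Adj x y := x ≠ y ∧ LabelsJoined x.1 y.1
  symm := ⟨fun _ _ h => ⟨h.1.symm, h.2.symm⟩⟩
  loopless := ⟨fun _ h => h.1 rfl⟩

theorem card_label_fiber {l m r M : ℕ} (x : Label m) :
    (Finset.univ.filter fun v : HubVertex l m r M => v.1 = x).card = labelSize l m r M x := by
  classical
  have : (Finset.univ.filter fun v : HubVertex l m r M => v.1 = x)
      = Finset.univ.map ⟨fun a => (⟨x, a⟩ : HubVertex l m r M),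
          sigma_mk_injective (β := fun x => Fin (labelSize l m r M x))⟩ := by
    ext ⟨y, a⟩
    simp only [Finset.mem_filter, Finset.mem_univ, true_and, Finset.mem_map,
      Function.Embedding.coeFn_mk]
    constructor
    · rintro rfl
      exact ⟨a, rfl⟩
    · rintro ⟨b, hb⟩
      exact (congrArg Sigma.fst hb).symm
  rw [this, Finset.card_map, Finset.card_univ, Fintype.card_fin]

theorem card_main {l m r M : ℕ} (hm : 0 < m) :
    (Finset.univ.filter fun v : HubVertex l m r M => v.1 ≠ .inl false).card
      = l + 3 * m + 2 * r := by
  classical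
  have h := Finset.card_filter_add_card_filter_not (s := (Finset.univ : Finset (HubVertex l m r M)))
    (fun v => v.1 = .inl false)
  rw [card_label_fiber, Finset.card_univ, Fintype.card_sigma] at h
  simp only [ne_eq]
  generalize (Finset.univ.filter fun v : HubVertex l m r M => ¬ v.1 = .inl false).card = c at *
  obtain ⟨m, rfl⟩ := Nat.exists_eq_add_of_lt hm
  have h0 : ∑ x : Fin (0 + m + 1), (if x.val = 0 then 2 * r else 0) = 2 * r := by
    rw [Fin.sum_univ_succ]
    simp
  simp only [Fintype.card_fin] at h
  simp only [Fintype.sum_sum_type, Fintype.sum_prod_type, Fintype.sum_bool, labelSize,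
    Finset.sum_add_distrib, Finset.sum_const, Finset.card_univ, Fintype.card_fin, smul_eq_mul,
    h0] at h
  omega

theorem SimpleGraph.Reachable.mem_of_closed {V : Type*} {H : SimpleGraph V} {P : V → Prop}
    (hP : ∀ x y, H.Adj x y → P x → P y) {x y : V} (h : H.Reachable x y) (hx : P x) : P y := by
  obtain ⟨w⟩ := h
  induction w with
  | nil => exact hx
  | cons hxy _ ih => exact ih (hP _ _ hxy hx)

/-- A component isomorphic to a path can be traversed by an injective sequence of vertices. -/
theorem exists_path_parametrization {V : Type*} {F : SimpleGraph V} {C : F.ConnectedComponent}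
    {L : ℕ} (hL : 0 < L) (φ : (F.induce C.supp) ≃g pathGraph L) :
    ∃ p : ℕ → V, (∀ v, F.connectedComponentMk v = C ↔ ∃ j < L, p j = v) ∧
      (∀ i < L, ∀ j < L, p i = p j → i = j) ∧
      (∀ i < L, ∀ j < L, F.Adj (p i) (p j) ↔ i + 1 = j ∨ j + 1 = i) := by
  have hp : ∀ j (hj : j < L), (if h : j < L then (φ.symm ⟨j, h⟩ : V) else φ.symm ⟨0, hL⟩)
      = φ.symm ⟨j, hj⟩ := fun j hj => dif_pos hj
  refine ⟨fun j => if h : j < L then φ.symm ⟨j, h⟩ else φ.symm ⟨0, hL⟩, ?_, ?_, ?_⟩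
  · intro v
    constructor
    · intro hv
      refine ⟨φ ⟨v, hv⟩, (φ ⟨v, hv⟩).isLt, ?_⟩
      exact (hp _ (φ ⟨v, hv⟩).isLt).trans (congrArg Subtype.val (φ.symm_apply_apply ⟨v, hv⟩))
    · rintro ⟨j, hj, rfl⟩
      simp only [hp _ hj]
      exact (φ.symm ⟨j, hj⟩).2
  · intro i hi j hj h
    simp only [hp _ hi, hp _ hj] at h
    simpa using φ.symm.injective (Subtype.ext h)
  · intro i hi j hj
    simp only [hp _ hi, hp _ hj]
    have := φ.symm.map_adj_iff (v := ⟨i, hi⟩) (w := ⟨j, hj⟩)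
    rw [SimpleGraph.induce_adj] at this
    rw [this, pathGraph_adj]

theorem card_supp_of_parametrization {V : Type*} [Fintype V] [DecidableEq V]
    {F : SimpleGraph V} [DecidableEq F.ConnectedComponent] {C : F.ConnectedComponent}
    {L : ℕ} {p : ℕ → V}
    (hp : ∀ v, F.connectedComponentMk v = C ↔ ∃ j < L, p j = v)
    (hinj : ∀ i < L, ∀ j < L, p i = p j → i = j) :
    (Finset.univ.filter fun v => F.connectedComponentMk v = C).card = L := by
  have : (Finset.univ.filter fun v => F.connectedComponentMk v = C)
      = (Finset.range L).image p := by
    ext v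
    simp [hp]
  rw [this, Finset.card_image_of_injOn, Finset.card_range]
  intro i hi j hj h
  exact hinj i (by simpa using hi) j (by simpa using hj) h

/-- In a factor, exactly two components lie outside the separate clique, and each blob contains
an end of one of them or a neighbour of a core vertex, which bounds the number of blobs. -/
theorem not_exists_factor_hubGraph {k l m r M : ℕ} (hk : 2 ≤ k) (hm : 2 * l + 5 ≤ m)
    (hn : l + 3 * m + 2 * r = 2 * k + 3) :
    ¬ ∃ F, IsP2P2k1Factor (hubGraph l m r M) k F := by
  classical
  rintro ⟨F, hFG, hF⟩
  have key : ∀ C : F.ConnectedComponent, ∃ (L : ℕ) (p : ℕ → HubVertex l m r M),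
      (L = 2 ∨ L = 2 * k + 1) ∧
      (∀ v, F.connectedComponentMk v = C ↔ ∃ j < L, p j = v) ∧
      (∀ i < L, ∀ j < L, p i = p j → i = j) ∧
      (∀ i < L, ∀ j < L, F.Adj (p i) (p j) ↔ i + 1 = j ∨ j + 1 = i) := by
    intro C
    rcases hF C with ⟨⟨φ⟩⟩ | ⟨⟨φ⟩⟩
    · obtain ⟨p, hp⟩ := exists_path_parametrization (by norm_num) φ
      exact ⟨2, p, .inl rfl, hp⟩
    · obtain ⟨p, hp⟩ := exists_path_parametrization (by omega) φ
      exact ⟨_, p, .inr rfl, hp⟩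
  choose L p hL hp hinj hadj using key
  have two_nbrs : ∀ x, ∃ y z, ∀ w, F.Adj x w → w = y ∨ w = z := by
    intro x
    obtain ⟨j, hj, hx⟩ := (hp (F.connectedComponentMk x) x).1 rfl
    refine ⟨p (F.connectedComponentMk x) (j - 1), p (F.connectedComponentMk x) (j + 1), ?_⟩
    intro w hw
    obtain ⟨i, hi, hwi⟩ := (hp (F.connectedComponentMk x) w).1
      (ConnectedComponent.sound hw.symm.reachable)
    rw [← hx, ← hwi, hadj _ _ hj _ hi] at hw
    rcases hw with h | h
    · right
      rw [← hwi, h]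
    · left
      rw [← hwi, ← h, Nat.add_sub_cancel]
  choose y z hyz using two_nbrs
  have closed : ∀ v w, F.Reachable v w → v.1 ≠ .inl false → w.1 ≠ .inl false := by
    intro v w h
    refine h.mem_of_closed (P := fun v => v.1 ≠ .inl false) ?_
    rintro ⟨a, a'⟩ ⟨b, b'⟩ hab ha rfl
    have := (hFG hab).2
    rcases a with (_ | _) | ⟨i, a⟩ <;> simp_all [LabelsJoined]
  set main := Finset.univ.filter fun v : HubVertex l m r M => v.1 ≠ .inl false with hmain
  set comps := main.image F.connectedComponentMk with hcomps
  have comps_card : comps.card ≤ 2 := by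
    have h1 : ∑ C ∈ comps, L C = 2 * k + 3 := by
      rw [← hn, ← card_main (M := M) (by omega : 0 < m), ← hmain,
        Finset.card_eq_sum_card_fiberwise (t := comps) (f := F.connectedComponentMk)
          fun v hv => Finset.mem_image_of_mem _ hv]
      refine Finset.sum_congr rfl fun C hC => ?_
      rw [← card_supp_of_parametrization (hp C) (hinj C)]
      congr 1
      ext v
      simp only [hmain, Finset.mem_filter, Finset.mem_univ, true_and]
      refine ⟨fun hv => ⟨?_, hv⟩, fun hv => hv.2⟩
      obtain ⟨w, hw, rfl⟩ := Finset.mem_image.1 hC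
      exact closed w v (ConnectedComponent.exact hv.symm) (Finset.mem_filter.1 hw).2
    have h2 : ∀ C ∈ comps, L C = 2 + (2 * k - 1) * if L C = 2 then 0 else 1 := by
      intro C _
      rcases hL C with h | h <;> rw [h] <;> split_ifs <;> omega
    rw [Finset.sum_congr rfl h2, Finset.sum_add_distrib, ← Finset.mul_sum, Finset.sum_const,
      smul_eq_mul] at h1
    set q := ∑ C ∈ comps, if L C = 2 then 0 else 1 with hq
    have hqc : q ≤ comps.card := by
      rw [Finset.card_eq_sum_ones]
      exact Finset.sum_le_sum fun C _ => by split_ifs <;> omega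
    rcases q with _ | _ | q
    · omega
    · omega
    · have : (2 * k - 1) * 2 ≤ (2 * k - 1) * (q + 1 + 1) := Nat.mul_le_mul_left _ (by omega)
      omega
  let g : (comps ⊕ Fin l) × Bool → HubVertex l m r M
    | (.inl C, false) => p C 0
    | (.inl C, true) => p C (L C - 1)
    | (.inr a, false) => y ⟨.inl true, a⟩
    | (.inr a, true) => z ⟨.inl true, a⟩
  have core_nbr : ∀ a w, F.Adj ⟨.inl true, a⟩ w → ∃ e, g e = w := by
    intro a w h
    rcases hyz _ _ h with h | h
    · exact ⟨(.inr a, false), h.symm⟩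
    · exact ⟨(.inr a, true), h.symm⟩
  have hit : ∀ i : Fin m, ∃ e, (g e).1 = .inr (i, false) := by
    intro i
    let w : HubVertex l m r M := ⟨.inr (i, false), ⟨0, by simp [labelSize]⟩⟩
    let C := F.connectedComponentMk w
    have hC : C ∈ comps := Finset.mem_image_of_mem _ (by simp [hmain, w])
    have nbr : ∀ v v', F.Adj v v' → v'.1 = .inr (i, false) →
        v.1 = .inr (i, false) ∨ v.1 = .inr (i, true) ∨ ∃ e, (g e).1 = .inr (i, false) := by
      rintro ⟨a, a'⟩ v' h hv'
      have hj := (hFG h).2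
      rw [hv'] at hj
      rcases a with (_ | _) | ⟨j, _ | _⟩
      · simp [LabelsJoined] at hj
      · obtain ⟨e, he⟩ := core_nbr _ _ h
        exact .inr (.inr ⟨e, he ▸ hv'⟩)
      · left
        simpa [LabelsJoined] using hj
      · right; left
        simpa [LabelsJoined] using hj
    let Q := (Finset.range (L C)).filter fun j => (p C j).1 = .inr (i, false)
    have hQ : Q.Nonempty := by
      obtain ⟨j, hj, h⟩ := (hp C w).1 rfl
      exact ⟨j, by simp [Q, hj, h, w]⟩
    have memQ : ∀ j, j ∈ Q ↔ j < L C ∧ (p C j).1 = .inr (i, false) := by simp [Q]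
    obtain ⟨j₀L, h₀⟩ := (memQ _).1 (Q.min'_mem hQ)
    obtain ⟨j₁L, h₁⟩ := (memQ _).1 (Q.max'_mem hQ)
    have min_le : ∀ j ∈ Q, Q.min' hQ ≤ j := fun j hj => Q.min'_le j hj
    have le_max : ∀ j ∈ Q, j ≤ Q.max' hQ := fun j hj => Q.le_max' j hj
    have hle := min_le _ (Q.max'_mem hQ)
    generalize Q.min' hQ = j₀ at *
    generalize Q.max' hQ = j₁ at *
    by_contra hne
    have j₀0 : j₀ ≠ 0 := by
      rintro rfl
      exact hne ⟨(.inl ⟨C, hC⟩, false), h₀⟩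
    have j₁0 : j₁ ≠ L C - 1 := by
      rintro rfl
      exact hne ⟨(.inl ⟨C, hC⟩, true), h₁⟩
    have e₀ : (p C (j₀ - 1)).1 = .inr (i, true) := by
      rcases nbr _ _ ((hadj C (j₀ - 1) (by omega) j₀ j₀L).2 (by omega)) h₀ with h | h | h
      · have := min_le _ ((memQ _).2 ⟨by omega, h⟩)
        omega
      · exact h
      · exact absurd h hne
    have e₁ : (p C (j₁ + 1)).1 = .inr (i, true) := by
      rcases nbr _ _ ((hadj C (j₁ + 1) (by omega) j₁ j₁L).2 (by omega)) h₁ with h | h | h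
      · have := le_max _ ((memQ _).2 ⟨by omega, h⟩)
        omega
      · exact h
      · exact absurd h hne
    have hub_unique : ∀ v v' : HubVertex l m r M,
        v.1 = .inr (i, true) → v'.1 = .inr (i, true) → v = v' := by
      rintro ⟨a, a'⟩ ⟨b, b'⟩ rfl hb
      obtain rfl : b = _ := hb
      congr 1
      exact Subsingleton.elim (α := Fin 1) a' b'
    have := hinj C _ (by omega) _ (by omega) (hub_unique _ _ e₀ e₁)
    omega
  choose e he using hit
  have einj : Function.Injective e := by
    intro i j hij
    have := (he i).symm.trans (hij ▸ he j)
    simpa using this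
  have := Fintype.card_le_of_injective e einj
  simp only [Fintype.card_fin, Fintype.card_prod, Fintype.card_sum, Fintype.card_coe,
    Fintype.card_bool] at this
  omega

/-- Summing the component counts counts the components of small odd order. -/
theorem sum_cComp_eq {V : Type*} [Finite V] (G : SimpleGraph V) (X : Set V) (k : ℕ) :
    ∑ j ∈ Finset.range k, cComp G X (2 * j + 1) =
      Nat.card {C : (G.induce Xᶜ).ConnectedComponent // ∃ j < k, Nat.card C.supp = 2 * j + 1} := by
  classical
  have := Fintype.ofFinite (G.induce Xᶜ).ConnectedComponent
  simp only [cComp, Nat.card_eq_fintype_card, Fintype.card_subtype]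
  rw [← Finset.card_biUnion]
  · congr 1
    ext C
    simp only [Finset.mem_biUnion, Finset.mem_range, Finset.mem_filter, Finset.mem_univ, true_and]
  · intro i _ j _ hij
    refine Finset.disjoint_filter.2 fun C _ h1 h2 => hij ?_
    omega

/-- A component of `G - X` containing a vertex `v` contains every vertex outside `X` whose label
is joined to that of `v`. -/
theorem mk_eq_of_labelsJoined {l m r M : ℕ} {X : Set (HubVertex l m r M)}
    {v w : ↥Xᶜ} (h : LabelsJoined v.1.1 w.1.1) :
    ((hubGraph l m r M).induce Xᶜ).connectedComponentMk v =
      ((hubGraph l m r M).induce Xᶜ).connectedComponentMk w := by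
  by_cases hne : v = w
  · rw [hne]
  · exact ConnectedComponent.sound (Adj.reachable ⟨fun h' => hne (Subtype.ext h'), h⟩)

/-- Vertices of `G - X` with equal labels lie in one component. -/
theorem card_components_le {l m r M : ℕ} (X : Set (HubVertex l m r M)) :
    Nat.card ((hubGraph l m r M).induce Xᶜ).ConnectedComponent ≤ 2 * m + 2 := by
  have hinj : Function.Injective
      fun C : ((hubGraph l m r M).induce Xᶜ).ConnectedComponent => C.nonempty_supp.some.1.1 := by
    intro C D h
    have h : C.nonempty_supp.some.1.1 = D.nonempty_supp.some.1.1 := h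
    rw [← show _ = C from C.nonempty_supp.some_mem, ← show _ = D from D.nonempty_supp.some_mem]
    refine mk_eq_of_labelsJoined ?_
    rw [h]
    exact LabelsJoined.refl _
  have hcard : Nat.card (Label m) = 2 * m + 2 := by
    simp only [Nat.card_eq_fintype_card, Fintype.card_sum, Fintype.card_prod, Fintype.card_bool,
      Fintype.card_fin]
    omega
  exact hcard ▸ Nat.card_le_card_of_injective _ hinj

/-- If every vertex of `A` outside `X` lies in the component `C` of `G - X`, then
`#A ≤ #C + #X`. -/
theorem card_le_card_supp_add {V : Type*} [Fintype V] {G : SimpleGraph V} {X : Set V}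
    {C : (G.induce Xᶜ).ConnectedComponent} {A : Finset V}
    (hA : ∀ v ∈ A, ∀ hv : v ∈ Xᶜ, (G.induce Xᶜ).connectedComponentMk ⟨v, hv⟩ = C) :
    A.card ≤ Nat.card C.supp + Nat.card X := by
  classical
  have := Fintype.ofFinite X
  have hsub : (A : Set V) ⊆ (Subtype.val '' C.supp) ∪ X := by
    intro v hv
    by_cases hX : v ∈ X
    · exact .inr hX
    · exact .inl ⟨⟨v, hX⟩, hA v hv hX, rfl⟩
  have h1 := Set.ncard_le_ncard hsub (Set.toFinite _)
  have h2 := Set.ncard_union_le (Subtype.val '' C.supp) X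
  rw [Set.ncard_image_of_injective _ Subtype.val_injective] at h2
  rw [Set.ncard_coe_finset] at h1
  simp only [Nat.card_coe_set_eq]
  omega

/-- The possible numbers of components of `G - X` of odd order below `2 * k`: there are none, or
`X` contains most of the separate clique, or `X` misses part of the core, or `X` contains the core
together with two vertices of each of `t` blocks. -/
theorem sum_cComp_hubGraph_le {k l m r M : ℕ} (hm : 0 < m)
    (hn : 2 * k + 3 ≤ l + 3 * m + 2 * r) (X : Set (HubVertex l m r M)) :
    ∑ j ∈ Finset.range k, cComp (hubGraph l m r M) X (2 * j + 1) = 0 ∨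
    (∑ j ∈ Finset.range k, cComp (hubGraph l m r M) X (2 * j + 1) ≤ 2 * m + 2 ∧
      M ≤ Nat.card X + 2 * k) ∨
    (∑ j ∈ Finset.range k, cComp (hubGraph l m r M) X (2 * j + 1) ≤ 1 ∧ 4 ≤ Nat.card X) ∨
    ∃ t ≤ m, ∑ j ∈ Finset.range k, cComp (hubGraph l m r M) X (2 * j + 1) ≤ t + 1 ∧
      l + 2 * t ≤ Nat.card X := by
  classical
  rw [sum_cComp_eq]
  set H := (hubGraph l m r M).induce Xᶜ with hH
  have := Fintype.ofFinite H.ConnectedComponent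
  rw [Nat.card_eq_fintype_card, Fintype.card_subtype]
  set D := Finset.univ.filter
    fun C : H.ConnectedComponent => ∃ j < k, Nat.card C.supp = 2 * j + 1 with hD
  have memD : ∀ C, C ∈ D ↔ ∃ j < k, Nat.card C.supp = 2 * j + 1 := by
    simp only [hD, Finset.mem_filter, Finset.mem_univ, true_and, implies_true]
  by_cases hD0 : D.card = 0
  · exact .inl hD0
  right
  by_cases hfar : ∃ v : ↥Xᶜ, v.1.1 = .inl false ∧ H.connectedComponentMk v ∈ D
  · left
    obtain ⟨v, hv, hvD⟩ := hfar
    refine ⟨?_, ?_⟩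
    · refine le_trans (Finset.card_le_univ _) ?_
      rw [← Nat.card_eq_fintype_card]
      exact card_components_le X
    · obtain ⟨j, hj, hc⟩ := (memD _).1 hvD
      have := card_le_card_supp_add (X := X) (C := H.connectedComponentMk v)
        (A := Finset.univ.filter fun v : HubVertex l m r M => v.1 = .inl false) (by
          intro w hw hwX
          refine mk_eq_of_labelsJoined ?_
          rw [hv, (Finset.mem_filter.1 hw).2]
          exact LabelsJoined.refl _)
      rw [card_label_fiber, hc] at this
      simp only [labelSize] at this
      omega
  right
  have hmain : ∀ v : ↥Xᶜ, H.connectedComponentMk v ∈ D → v.1.1 ≠ .inl false :=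
    fun v hv h => hfar ⟨v, h, hv⟩
  by_cases hcore : ∃ z : ↥Xᶜ, z.1.1 = .inl true
  · left
    obtain ⟨z, hz⟩ := hcore
    have hall : ∀ v : ↥Xᶜ, v.1.1 ≠ .inl false →
        H.connectedComponentMk v = H.connectedComponentMk z :=
      fun v hv => mk_eq_of_labelsJoined (hz ▸ labelsJoined_core hv)
    have hDz : ∀ C ∈ D, C = H.connectedComponentMk z := by
      intro C
      induction C using ConnectedComponent.ind with
      | h v => exact fun hv => hall v (hmain v hv)
    refine ⟨Finset.card_le_one.2 fun C hC C' hC' => (hDz C hC).trans (hDz C' hC').symm, ?_⟩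
    obtain ⟨C, hC⟩ := Finset.card_pos.1 (Nat.pos_of_ne_zero hD0)
    obtain ⟨j, hj, hc⟩ := (memD _).1 hC
    have := card_le_card_supp_add (X := X) (C := C)
      (A := Finset.univ.filter fun v : HubVertex l m r M => v.1 ≠ .inl false) (by
        intro w hw hwX
        rw [hDz C hC]
        exact hall ⟨w, hwX⟩ (Finset.mem_filter.1 hw).2)
    rw [card_main hm, hc] at this
    omega
  right
  have core_mem : ∀ v : HubVertex l m r M, v.1 = .inl true → v ∈ X := by
    intro v hv
    by_contra hX
    exact hcore ⟨⟨v, hX⟩, hv⟩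
  let T := D.filter fun C => ∀ v : ↥Xᶜ, H.connectedComponentMk v = C → ∀ i, v.1.1 ≠ .inr (i, true)
  have hDT : D.card ≤ T.card + 1 := by
    rw [← Finset.card_filter_add_card_filter_not (s := D)
      (fun C => ∀ v : ↥Xᶜ, H.connectedComponentMk v = C → ∀ i, v.1.1 ≠ .inr (i, true))]
    refine Nat.add_le_add_left (Finset.card_le_one.2 ?_) _
    intro C hC C' hC'
    have h := (Finset.mem_filter.1 hC).2
    have h' := (Finset.mem_filter.1 hC').2
    push Not at h h'
    obtain ⟨v, rfl, i, hi⟩ := h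
    obtain ⟨v', rfl, i', hi'⟩ := h'
    refine mk_eq_of_labelsJoined ?_
    rw [hi, hi']
    simp [LabelsJoined]
  have blob : ∀ C ∈ T, ∃ i : Fin m,
      (∃ v : ↥Xᶜ, v.1.1 = .inr (i, false) ∧ H.connectedComponentMk v = C) ∧
      ∃ b : HubVertex l m r M, b ∈ X ∧ b.1 = .inr (i, false) ∧
      ∃ a : HubVertex l m r M, a ∈ X ∧ a.1 = .inr (i, true) := by
    intro C hC
    obtain ⟨hCD, hCT⟩ := Finset.mem_filter.1 hC
    induction C using ConnectedComponent.ind with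
    | h v =>
    have label : ∀ w : ↥Xᶜ, H.connectedComponentMk w = H.connectedComponentMk v →
        ∃ i, w.1.1 = .inr (i, false) := by
      intro w hw
      have h1 := hCT w hw
      have h2 := hmain w (hw ▸ hCD)
      have h3 := fun h => w.2 (core_mem w.1 h)
      rcases hx : w.1.1 with (_ | _) | ⟨i, _ | _⟩
      · exact absurd hx h2
      · exact absurd hx h3
      · exact ⟨i, rfl⟩
      · exact absurd hx (h1 i)
    obtain ⟨i, hi⟩ := label v rfl
    have hsame : ∀ w : ↥Xᶜ, w.1.1 = .inr (i, false) →
        H.connectedComponentMk w = H.connectedComponentMk v := by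
      intro w hw
      refine mk_eq_of_labelsJoined ?_
      rw [hw, hi]
      exact LabelsJoined.refl _
    refine ⟨i, ⟨v, hi, rfl⟩, ?_⟩
    have hb : ∃ b : HubVertex l m r M, b ∈ X ∧ b.1 = .inr (i, false) := by
      by_contra! hno
      obtain ⟨j, hj, hc⟩ := (memD _).1 hCD
      have hsub : ∀ w, H.Reachable v w → w.1.1 = .inr (i, false) := by
        intro w hw
        have : w.1.1 = .inr (i, false) ∧ H.Reachable v w := by
          refine hw.mem_of_closed
            (P := fun w => w.1.1 = .inr (i, false) ∧ H.Reachable v w) ?_ ⟨hi, .rfl⟩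
          rintro x y hxy ⟨hx, hvx⟩
          have hvy := hvx.trans hxy.reachable
          refine ⟨?_, hvy⟩
          obtain ⟨i', hi'⟩ := label y (ConnectedComponent.sound hvy.symm)
          have := hxy.2
          simp only [Function.Embedding.subtype_apply] at this
          rw [hx, hi'] at this
          simp only [LabelsJoined, Bool.false_eq_true, and_self, or_false] at this
          rw [hi', this]
        exact this.1
      have heq : Subtype.val '' (H.connectedComponentMk v).supp
          = (Finset.univ.filter fun v : HubVertex l m r M => v.1 = .inr (i, false) : Finset _) := by
        ext w
        simp only [Finset.coe_filter, Finset.mem_univ, true_and, Set.mem_ofPred_eq, Set.mem_image]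
        constructor
        · rintro ⟨w, hw, rfl⟩
          exact hsub w (ConnectedComponent.exact hw).symm
        · intro hw
          exact ⟨⟨w, fun hX => hno w hX hw⟩, hsame _ hw, rfl⟩
      have hcard := congrArg Set.ncard heq
      rw [Set.ncard_image_of_injective _ Subtype.val_injective, Set.ncard_coe_finset,
        card_label_fiber, ← Nat.card_coe_set_eq, hc] at hcard
      simp only [labelSize] at hcard
      split_ifs at hcard <;> omega
    obtain ⟨b, hbX, hbl⟩ := hb
    refine ⟨b, hbX, hbl, ⟨.inr (i, true), ⟨0, by simp [labelSize]⟩⟩, ?_, rfl⟩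
    by_contra hX
    refine hCT ⟨_, hX⟩ (mk_eq_of_labelsJoined ?_) i rfl
    rw [hi]
    simp [LabelsJoined]
  choose ι hv hb using fun C : T => blob C.1 C.2
  choose v hv hvC using hv
  choose b hbX hbl a haX hal using hb
  have ι_inj : Function.Injective ι := by
    intro C C' h
    refine Subtype.ext ((hvC C).symm.trans (Eq.trans (mk_eq_of_labelsJoined ?_) (hvC C')))
    rw [hv C, hv C', h]
    exact LabelsJoined.refl _
  refine ⟨T.card, ?_, hDT, ?_⟩
  · simpa using Fintype.card_le_of_injective ι ι_inj
  let f : Fin l ⊕ T × Bool → X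
    | .inl c => ⟨⟨.inl true, c⟩, core_mem _ rfl⟩
    | .inr (C, false) => ⟨b C, hbX C⟩
    | .inr (C, true) => ⟨a C, haX C⟩
  have hf : Function.Injective f := by
    intro x y h
    have hlab := congrArg (fun v : X => v.1.1) h
    rcases x with c | ⟨C, _ | _⟩ <;> rcases y with c' | ⟨C', _ | _⟩ <;>
      simp only [f, hbl, hal, reduceCtorEq, Sum.inr.injEq, Prod.mk.injEq, and_true, and_false]
        at hlab
    · have h : (⟨.inl true, c⟩ : HubVertex l m r M) = ⟨.inl true, c'⟩ := congrArg Subtype.val h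
      rw [sigma_mk_injective (β := fun x => Fin (labelSize l m r M x)) h]
    · rw [ι_inj hlab]
    · rw [ι_inj hlab]
  have := Nat.card_le_card_of_injective f hf
  simp only [Nat.card_eq_fintype_card, Fintype.card_sum, Fintype.card_prod, Fintype.card_bool,
    Fintype.card_fin, Fintype.card_coe] at this
  rw [Nat.card_eq_fintype_card]
  omega

/-- For every integer `k ≥ 29` and every integer `N`, there exists a finite simple graph `G`
with more than `N` vertices having no `{P₂, P_{2k+1}}`-factor such that
`∑_{0 ≤ j ≤ k-1} c_{2j+1}(G - X) ≤ ((32k+141)/(72k-78))·|X|` for all `X ⊆ V(G)`. -/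
theorem stmt1 (k : ℕ) (hk : 29 ≤ k) (N : ℤ) :
    ∃ (V : Type) (_ : Fintype V) (G : SimpleGraph V),
      N < (Nat.card V : ℤ) ∧
      (¬ ∃ F, IsP2P2k1Factor G k F) ∧
      ∀ X : Set V, (∑ j ∈ Finset.range k, (cComp G X (2 * j + 1) : ℝ)) ≤
        ((32 * (k : ℝ) + 141) / (72 * (k : ℝ) - 78)) * Nat.card X := by
  have hkR : (29 : ℝ) ≤ k := by exact_mod_cast hk
  set c : ℝ := (32 * (k : ℝ) + 141) / (72 * (k : ℝ) - 78) with hc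
  have hc4 : 4 / 9 ≤ c := by
    rw [hc, div_le_div_iff₀ (by norm_num) (by linarith)]
    linarith
  obtain ⟨l, m, hm, hlm, hpar, hbd⟩ : ∃ l m : ℕ, 2 * l + 5 ≤ m ∧
      l + 3 * m ≤ 2 * k + 3 ∧ (l + m) % 2 = 1 ∧
      ∀ t x : ℕ, t ≤ m → l + 2 * t ≤ x → (t : ℝ) + 1 ≤ c * x := by
    rcases le_or_gt k 45 with h | h
    · have hkR' : (k : ℝ) ≤ 45 := by exact_mod_cast h
      have hc2 : 1 / 2 ≤ c := by
        rw [hc, div_le_div_iff₀ (by norm_num) (by linarith)]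
        linarith
      refine ⟨2, 9, by omega, by omega, by omega, fun t x _ hx => ?_⟩
      have hx : (2 : ℝ) + 2 * t ≤ x := by exact_mod_cast hx
      nlinarith
    · refine ⟨8, 21, by omega, by omega, by omega, fun t x ht hx => ?_⟩
      have hx : (8 : ℝ) + 2 * t ≤ x := by exact_mod_cast hx
      have ht : (t : ℝ) ≤ 21 := by exact_mod_cast ht
      nlinarith
  set r := (2 * k + 3 - (l + 3 * m)) / 2 with hr
  have hn : l + 3 * m + 2 * r = 2 * k + 3 := by omega
  set M := N.toNat + 2 * k + 5 * m + 5 with hM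
  refine ⟨HubVertex l m r M, inferInstance, hubGraph l m r M, ?_,
    not_exists_factor_hubGraph (by omega) hm hn, fun X => ?_⟩
  · have h1 := card_label_fiber (l := l) (r := r) (M := M) (.inl false : Label m)
    have h2 := Finset.card_le_univ
      (Finset.univ.filter fun v : HubVertex l m r M => v.1 = .inl false)
    rw [h1, ← Nat.card_eq_fintype_card] at h2
    simp only [labelSize] at h2
    omega
  · rw [← Nat.cast_sum]
    have h := sum_cComp_hubGraph_le (by omega) hn.ge X
    generalize ∑ j ∈ Finset.range k, cComp (hubGraph l m r M) X (2 * j + 1) = S at *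
    generalize Nat.card X = x at *
    have hx0 : (0 : ℝ) ≤ x := x.cast_nonneg
    rcases h with h | ⟨h, hx⟩ | ⟨h, hx⟩ | ⟨t, ht, h, hx⟩
    · rw [h, Nat.cast_zero]
      positivity
    · have h : (S : ℝ) ≤ 2 * m + 2 := by exact_mod_cast h
      have hx : (5 : ℝ) * m + 5 ≤ x := by
        have : 5 * m + 5 ≤ x := by omega
        exact_mod_cast this
      nlinarith
    · have h : (S : ℝ) ≤ 1 := by exact_mod_cast h
      have hx : (4 : ℝ) ≤ x := by exact_mod_cast hx
      nlinarith
    · have h : (S : ℝ) ≤ t + 1 := by exact_mod_cast h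
      exact h.trans (hbd t x ht hx)
end

section
/- Let 𝓕 be a set of connected graphs with P₂ ∈ 𝓕, and let G be a finite simple graph. If b_𝓕(G−X) ≤ |X| for all X ⊆ V(G), then G has an 𝓕-factor. -/
open SimpleGraph

/-- A graph is hypomatchable if deleting any vertex leaves a graph with a perfect matching. -/
def Hypomatchable {V : Type*} (G : SimpleGraph V) : Prop :=
  ∀ u : V, ∃ M : (G.induce {u}ᶜ).Subgraph, M.IsPerfectMatching

/-- `F` is an `𝓕`-factor of `G` : a spanning subgraph each of whose connected components is
isomorphic to a member of the family `𝓕`. -/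
def IsFamilyFactor {V : Type} (𝓕 : Set (Σ W : Type, SimpleGraph W))
    (G : SimpleGraph V) (F : SimpleGraph V) : Prop :=
  F ≤ G ∧ ∀ C : F.ConnectedComponent, ∃ H ∈ 𝓕, Nonempty ((F.induce C.supp) ≃g H.2)

/-- `b_𝓕(G - X)` : the number of connected components of `G - X` that are hypomatchable and
have no `𝓕`-factor. -/
noncomputable def bF {V : Type} (𝓕 : Set (Σ W : Type, SimpleGraph W))
    (G : SimpleGraph V) (X : Set V) : ℕ :=
  Nat.card {C : (G.induce Xᶜ).ConnectedComponent //
    Hypomatchable ((G.induce Xᶜ).induce C.supp) ∧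
    ¬ ∃ F, IsFamilyFactor 𝓕 ((G.induce Xᶜ).induce C.supp) F}


section Tilings

variable {V W : Type} {𝓕 : Set (Σ W : Type, SimpleGraph W)} {G : SimpleGraph V}

/-- `P` is the vertex set of a copy in `G` of a member of `𝓕`. -/
def IsTile (𝓕 : Set (Σ W : Type, SimpleGraph W)) (G : SimpleGraph V) (P : Set V) : Prop :=
  ∃ H ∈ 𝓕, ∃ f : H.2 →g G, Function.Injective f ∧ Set.range f = P

/-- `A` can be partitioned into vertex sets of copies of members of `𝓕`. -/
def Tileable (𝓕 : Set (Σ W : Type, SimpleGraph W)) (G : SimpleGraph V) (A : Set V) : Prop :=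
  ∃ 𝒯 : Set (Set V), (∀ P ∈ 𝒯, IsTile 𝓕 G P) ∧
    (∀ P ∈ 𝒯, ∀ Q ∈ 𝒯, ∀ v, v ∈ P → v ∈ Q → P = Q) ∧ ⋃₀ 𝒯 = A

theorem Tileable.iUnion {ι : Type} {A : ι → Set V} (hA : ∀ i, Tileable 𝓕 G (A i))
    (hdisj : ∀ i j v, v ∈ A i → v ∈ A j → i = j) : Tileable 𝓕 G (⋃ i, A i) := by
  choose 𝒯 htile hpart hunion using hA
  refine ⟨⋃ i, 𝒯 i, ?_, ?_, ?_⟩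
  · simp only [Set.mem_iUnion]
    rintro P ⟨i, hi⟩
    exact htile i P hi
  · simp only [Set.mem_iUnion]
    rintro P ⟨i, hi⟩ Q ⟨j, hj⟩ v hvP hvQ
    obtain rfl : i = j :=
      hdisj i j v (hunion i ▸ ⟨P, hi, hvP⟩) (hunion j ▸ ⟨Q, hj, hvQ⟩)
    exact hpart i P hi Q hj v hvP hvQ
  · simp only [Set.sUnion_iUnion, hunion]

theorem SimpleGraph.Subgraph.IsMatching.tileable {M : G.Subgraph} (hM : M.IsMatching)
    (hP2 : (⟨Fin 2, pathGraph 2⟩ : Σ W : Type, SimpleGraph W) ∈ 𝓕) :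
    Tileable 𝓕 G M.verts := by
  refine ⟨{P | ∃ u v, M.Adj u v ∧ P = {u, v}}, ?_, ?_, ?_⟩
  · rintro P ⟨u, v, huv, rfl⟩
    refine ⟨_, hP2, ⟨![u, v], ?_⟩, ?_, ?_⟩
    · intro a b hab
      have hab' := pathGraph_adj.1 hab
      fin_cases a <;> fin_cases b <;> simp_all [huv.adj_sub, huv.adj_sub.symm]
    · have := huv.adj_sub.ne
      intro a b hab
      fin_cases a <;> fin_cases b <;> simp_all
    · change Set.range ![u, v] = _
      simp [Matrix.range_cons, Matrix.range_empty]
      exact Set.pair_comm v u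
  · rintro P ⟨u, v, huv, rfl⟩ Q ⟨u', v', huv', rfl⟩ w hw hw'
    simp only [Set.mem_insert_iff, Set.mem_singleton_iff] at hw hw'
    obtain rfl | rfl := hw <;> obtain rfl | rfl := hw'
    · rw [hM.eq_of_adj_left huv huv']
    · rw [hM.eq_of_adj_left huv huv'.symm, Set.pair_comm]
    · rw [hM.eq_of_adj_left huv.symm huv', Set.pair_comm]
    · rw [hM.eq_of_adj_right huv huv']
  · ext v
    simp only [Set.mem_sUnion, Set.mem_ofPred_eq]
    constructor
    · rintro ⟨_, ⟨u, w, huw, rfl⟩, rfl | rfl⟩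
      exacts [huw.fst_mem, huw.snd_mem]
    · intro hv
      obtain ⟨w, hw, -⟩ := hM hv
      exact ⟨_, ⟨v, w, hw, rfl⟩, by simp⟩

theorem IsFamilyFactor.tileable_range {G' F : SimpleGraph W} (hF : IsFamilyFactor 𝓕 G' F)
    (e : G' ↪g G) : Tileable 𝓕 G (Set.range e) := by
  refine ⟨Set.range fun C : F.ConnectedComponent => e '' C.supp, ?_, ?_, ?_⟩
  · rintro _ ⟨C, rfl⟩
    obtain ⟨H, hH, ⟨φ⟩⟩ := hF.2 C
    refine ⟨H, hH, ⟨fun a => e (φ.symm a).1, fun {a b} hab => ?_⟩, ?_, ?_⟩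
    · exact e.map_rel_iff.2 (hF.1 (φ.symm.map_rel_iff.2 hab))
    · exact e.injective.comp (Subtype.val_injective.comp φ.symm.injective)
    · change Set.range (e ∘ Subtype.val ∘ φ.symm) = _
      rw [Set.range_comp, Set.range_comp, φ.symm.surjective.range_eq, Set.image_univ,
        Subtype.range_coe]
  · rintro _ ⟨C, rfl⟩ _ ⟨D, rfl⟩ _ ⟨v, hv, rfl⟩ ⟨w, hw, hvw⟩
    obtain rfl := e.injective hvw
    rw [ConnectedComponent.mem_supp_iff] at hv hw
    rw [← hv, ← hw]
  · ext v
    constructor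
    · rintro ⟨_, ⟨C, rfl⟩, w, -, rfl⟩
      exact ⟨w, rfl⟩
    · rintro ⟨w, rfl⟩
      exact ⟨_, ⟨F.connectedComponentMk w, rfl⟩, w, rfl, rfl⟩

theorem Tileable.exists_isFamilyFactor (hconn : ∀ H ∈ 𝓕, H.2.Connected)
    (h : Tileable 𝓕 G Set.univ) : ∃ F, IsFamilyFactor 𝓕 G F := by
  obtain ⟨𝒯, htile, hpart, hunion⟩ := h
  choose H hH f hf hrange using htile
  have key : ∀ P hP a, f P hP a ∈ P := fun P hP a =>
    (hrange P hP).subset ⟨a, rfl⟩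
  let F : SimpleGraph V :=
    { Adj := fun u v => ∃ P, ∃ hP : P ∈ 𝒯, ∃ a b, (H P hP).2.Adj a b ∧
        f P hP a = u ∧ f P hP b = v
      symm := ⟨by
        rintro u v ⟨P, hP, a, b, hab, rfl, rfl⟩
        exact ⟨P, hP, b, a, hab.symm, rfl, rfl⟩⟩
      loopless := ⟨by
        rintro u ⟨P, hP, a, b, hab, rfl, hba⟩
        exact hab.ne (hf P hP hba.symm)⟩ }
  have hclosed : ∀ P ∈ 𝒯, ∀ u v, F.Reachable u v → u ∈ P → v ∈ P := by
    rintro P hP u v ⟨p⟩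
    induction p with
    | nil => exact id
    | cons hadj p ih =>
      intro hu
      obtain ⟨Q, hQ, a, b, -, rfl, rfl⟩ := hadj
      obtain rfl := hpart P hP Q hQ _ hu (key Q hQ a)
      exact ih (key P hP b)
  refine ⟨F, ?_, ?_⟩
  · rintro u v ⟨P, hP, a, b, hab, rfl, rfl⟩
    exact (f P hP).map_rel hab
  · intro C
    induction C using ConnectedComponent.ind with | _ v
    obtain ⟨P, hP, hvP⟩ : v ∈ ⋃₀ 𝒯 := hunion ▸ Set.mem_univ v
    have hvr := hvP
    rw [← hrange P hP] at hvr
    obtain ⟨a₀, rfl⟩ := hvr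
    let g : (H P hP).2 →g F := ⟨f P hP, fun {a b} hab => ⟨P, hP, a, b, hab, rfl, rfl⟩⟩
    have hmem : ∀ a, f P hP a ∈ (F.connectedComponentMk (f P hP a₀)).supp := fun a =>
      ConnectedComponent.sound (((hconn _ (hH P hP)).preconnected a a₀).map g)
    refine ⟨H P hP, hH P hP, ⟨RelIso.symm
      ⟨Equiv.ofBijective (fun a => ⟨f P hP a, hmem a⟩) ⟨?_, ?_⟩, ?_⟩⟩⟩
    · intro a b hab
      exact hf P hP (congrArg Subtype.val hab)
    · rintro ⟨w, hw⟩
      have hwP := hclosed P hP _ w (ConnectedComponent.exact hw).symm hvP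
      rw [← hrange P hP] at hwP
      obtain ⟨a, rfl⟩ := hwP
      exact ⟨a, rfl⟩
    · intro a b
      constructor
      · rintro ⟨Q, hQ, a', b', hab, ha, hb⟩
        obtain rfl := hpart P hP Q hQ _ (key P hP a) (by
          have := key Q hQ a'
          rwa [ha] at this)
        obtain rfl := hf P hP ha
        obtain rfl := hf P hP hb
        exact hab
      · intro hab
        exact ⟨P, hP, a, b, hab, rfl, rfl⟩

end Tilings

section Matchings

variable {V W : Type*} {G : SimpleGraph V} {G' : SimpleGraph W}

theorem SimpleGraph.Subgraph.IsPerfectMatching.exists_isMatching_verts_eq_range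
    {M : G'.Subgraph} (hM : M.IsPerfectMatching) (e : G' ↪g G) :
    ∃ N : G.Subgraph, N.IsMatching ∧ N.verts = Set.range e := by
  refine ⟨M.map e.toHom, hM.1.map e.toHom e.injective, ?_⟩
  rw [Subgraph.map_verts, Subgraph.isSpanning_iff.1 hM.2, Set.image_univ]
  rfl

theorem SimpleGraph.Subgraph.IsMatching.exists_isPerfectMatching_of_range
    {M : G.Subgraph} (hM : M.IsMatching) (e : G' ↪g G) (hverts : M.verts = Set.range e) :
    ∃ N : G'.Subgraph, N.IsPerfectMatching := by
  refine ⟨M.comap e.toHom, Subgraph.isPerfectMatching_iff.2 fun v => ?_⟩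
  obtain ⟨w, hw, huniq⟩ := hM (hverts ▸ ⟨v, rfl⟩ : e v ∈ M.verts)
  obtain ⟨w, rfl⟩ : w ∈ Set.range e := hverts ▸ hw.snd_mem
  refine ⟨w, ⟨e.map_rel_iff.1 hw.adj_sub, hw⟩, ?_⟩
  rintro w' ⟨-, hw'⟩
  exact e.injective (huniq _ hw')

end Matchings

section Barriers

variable {V : Type*} {G : SimpleGraph V}

/-- `𝒞` consists of vertex sets of odd components of `G - X`. -/
structure IsBarrier_s2 (G : SimpleGraph V) (X : Finset V) (𝒞 : Finset (Finset V)) : Prop where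
  odd : ∀ C ∈ 𝒞, Odd C.card
  notMem : ∀ C ∈ 𝒞, ∀ v ∈ C, v ∉ X
  eq_of_mem : ∀ C ∈ 𝒞, ∀ D ∈ 𝒞, ∀ v, v ∈ C → v ∈ D → C = D
  closed : ∀ C ∈ 𝒞, ∀ u ∈ C, ∀ v, G.Adj u v → v ∈ C ∨ v ∈ X
  conn : ∀ C ∈ 𝒞, ∀ p : V → Prop, ∀ c ∈ C, p c →
    (∀ u ∈ C, p u → ∀ v ∈ C, G.Adj u v → p v) → ∀ v ∈ C, p v

open Classical in
theorem exists_isBarrier_of_no_isPerfectMatching [Fintype V]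
    (h : ∀ M : G.Subgraph, ¬ M.IsPerfectMatching) :
    ∃ S 𝒟, IsBarrier_s2 G S 𝒟 ∧ S.card < 𝒟.card ∧
      (Even (Fintype.card V) → S.card + 2 ≤ 𝒟.card) := by
  obtain ⟨S, hS⟩ : ∃ S, G.IsTutteViolator S := by
    by_contra! hS
    obtain ⟨M, hM⟩ := tutte.2 hS
    exact h M hM
  unfold IsTutteViolator at hS
  set K := ((⊤ : G.Subgraph).deleteVerts S).coe with hK
  have hverts : ∀ v, v ∈ ((⊤ : G.Subgraph).deleteVerts S).verts ↔ v ∉ S := by simp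
  have hadj : ∀ u v, K.Adj u v ↔ G.Adj u.1 v.1 := by
    intro u v
    have hu := (hverts _).1 u.2
    have hv := (hverts _).1 v.2
    simp [hK, hu, hv]
  let g : K.ConnectedComponent → Finset V := fun c => (Subtype.val '' c.supp).toFinset
  have hg : ∀ c v, v ∈ g c ↔ ∃ hv, K.connectedComponentMk ⟨v, hv⟩ = c := by
    intro c v
    simp only [g, Set.mem_toFinset, Set.mem_image, ConnectedComponent.mem_supp_iff]
    constructor
    · rintro ⟨⟨w, hw⟩, hc, rfl⟩
      exact ⟨hw, hc⟩
    · rintro ⟨hv, hc⟩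
      exact ⟨⟨v, hv⟩, hc, rfl⟩
  have hginj : Function.Injective g := by
    intro c d hcd
    induction c using ConnectedComponent.ind with | _ v
    have : v.1 ∈ g d := hcd ▸ (hg _ _).2 ⟨v.2, rfl⟩
    exact ((hg _ _).1 this).2
  have hcard : (K.oddComponents.toFinset.image g).card = K.oddComponents.ncard := by
    rw [Finset.card_image_of_injective _ hginj, Set.ncard_eq_toFinset_card']
  have hScard : S.toFinset.card = S.ncard := (Set.ncard_eq_toFinset_card' S).symm
  refine ⟨S.toFinset, K.oddComponents.toFinset.image g, ⟨?_, ?_, ?_, ?_, ?_⟩, ?_, ?_⟩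
  · simp only [Finset.forall_mem_image, Set.mem_toFinset]
    intro c hc
    have : (g c).card = c.supp.ncard := by
      rw [← Set.ncard_image_of_injective _ Subtype.val_injective, Set.ncard_eq_toFinset_card']
    rw [this]
    exact hc
  · simp only [Finset.forall_mem_image, Set.mem_toFinset]
    intro c _ v hv
    exact (hverts v).1 ((hg _ _).1 hv).1
  · simp only [Finset.forall_mem_image]
    intro c _ d _ v hc hd
    obtain ⟨_, rfl⟩ := (hg _ _).1 hc
    obtain ⟨_, rfl⟩ := (hg _ _).1 hd
    rfl
  · simp only [Finset.forall_mem_image, Set.mem_toFinset]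
    intro c _ u hu v huv
    obtain ⟨hu', rfl⟩ := (hg _ _).1 hu
    by_cases hv : v ∈ S
    · exact Or.inr hv
    · refine Or.inl ((hg _ _).2 ⟨(hverts v).2 hv, ConnectedComponent.sound ?_⟩)
      exact ((hadj ⟨v, (hverts v).2 hv⟩ ⟨u, hu'⟩).2 huv.symm).reachable
  · simp only [Finset.forall_mem_image]
    intro c _ p v hv hpv hp w hw
    obtain ⟨hv', rfl⟩ := (hg _ _).1 hv
    obtain ⟨hw', hwv⟩ := (hg _ _).1 hw
    have aux : ∀ x y, K.Reachable x y →
        K.connectedComponentMk x = K.connectedComponentMk ⟨v, hv'⟩ → p x.1 → p y.1 := by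
      rintro x y ⟨q⟩
      induction q with
      | nil => exact fun _ => id
      | @cons x y z hxy q ih =>
        intro hx hpx
        have hy : K.connectedComponentMk y = K.connectedComponentMk ⟨v, hv'⟩ := by
          rw [← hx]
          exact ConnectedComponent.sound hxy.symm.reachable
        exact ih hy (hp _ ((hg _ _).2 ⟨x.2, hx⟩) hpx _ ((hg _ _).2 ⟨y.2, hy⟩) ((hadj _ _).1 hxy))
    exact aux ⟨v, hv'⟩ ⟨w, hw'⟩ (ConnectedComponent.exact hwv).symm rfl hpv
  · rw [hcard, hScard]
    exact hS
  · rw [hcard, hScard]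
    intro heven
    have hpar := odd_ncard_oddComponents K
    have hsum : S.ncard + Nat.card ((⊤ : G.Subgraph).deleteVerts S).verts = Fintype.card V := by
      rw [← Nat.card_eq_fintype_card, Nat.card_coe_set_eq, ← Set.ncard_add_ncard_compl S]
      congr 2
      ext v
      simp
    by_contra! hlt
    have heq : K.oddComponents.ncard = S.ncard + 1 := by omega
    rw [heq] at hpar
    rw [← hsum] at heven
    grind

theorem IsBarrier_s2.subset {X : Finset V} {𝒞 𝒞₀ : Finset (Finset V)} (h : IsBarrier_s2 G X 𝒞)
    (h𝒞 : 𝒞₀ ⊆ 𝒞) : IsBarrier_s2 G X 𝒞₀ :=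
  ⟨fun C hC => h.odd C (h𝒞 hC), fun C hC => h.notMem C (h𝒞 hC),
    fun C hC D hD => h.eq_of_mem C (h𝒞 hC) D (h𝒞 hD), fun C hC => h.closed C (h𝒞 hC),
    fun C hC => h.conn C (h𝒞 hC)⟩

open Classical in
theorem IsBarrier_s2.insert {X : Finset V} {𝒞 : Finset (Finset V)} (h : IsBarrier_s2 G X 𝒞) {z : V}
    (hz : ∀ C ∈ 𝒞, z ∉ C) : IsBarrier_s2 G (insert z X) 𝒞 where
  odd := h.odd
  notMem C hC v hv := by
    have := h.notMem C hC v hv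
    have := hz C hC
    grind
  eq_of_mem := h.eq_of_mem
  closed C hC u hu v huv := by
    have := h.closed C hC u hu v huv
    grind
  conn := h.conn

theorem IsBarrier_s2.restrict_separator {X Y : Finset V} {𝒞 : Finset (Finset V)}
    (h : IsBarrier_s2 G X 𝒞) (hYX : Y ⊆ X)
    (hY : ∀ C ∈ 𝒞, ∀ u ∈ C, ∀ x ∈ X, G.Adj u x → x ∈ Y) : IsBarrier_s2 G Y 𝒞 where
  odd := h.odd
  notMem C hC v hv hvY := h.notMem C hC v hv (hYX hvY)
  eq_of_mem := h.eq_of_mem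
  closed C hC u hu v huv := (h.closed C hC u hu v huv).imp_right fun hv => hY C hC u hu v hv huv
  conn := h.conn

open Classical in
theorem IsBarrier_s2.exists_extend [Fintype V] {X A : Finset V} {𝒞 : Finset (Finset V)}
    (h : IsBarrier_s2 G X 𝒞) (hAX : ∀ v ∈ A, v ∉ X) (hA𝒞 : ∀ C ∈ 𝒞, ∀ v ∈ C, v ∉ A)
    (hA : ∀ u ∈ A, ∀ v, G.Adj u v → v ∈ A ∨ v ∈ X)
    (hM : ¬ ∃ M : G.Subgraph, M.IsMatching ∧ M.verts = A) :
    ∃ X' 𝒞', IsBarrier_s2 G X' 𝒞' ∧ X.card ≤ X'.card ∧ X'.card + 𝒞.card < X.card + 𝒞'.card ∧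
      (Even A.card → X'.card + 𝒞.card + 2 ≤ X.card + 𝒞'.card) := by
  have hno : ∀ M : (G.induce (A : Set V)).Subgraph, ¬ M.IsPerfectMatching := by
    intro M hM'
    obtain ⟨N, hN, hv⟩ := hM'.exists_isMatching_verts_eq_range (Embedding.induce (A : Set V))
    exact hM ⟨N, hN, hv.trans Subtype.range_coe⟩
  obtain ⟨S, 𝒟, hB, hlt, hev⟩ := exists_isBarrier_of_no_isPerfectMatching hno
  have hcardA : Fintype.card (A : Set V) = A.card := by simp
  rw [hcardA] at hev
  let ι : (A : Set V) ↪ V := Function.Embedding.subtype _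
  have hι : ∀ x, ι x ∈ A := fun x => x.2
  have hS : ∀ v ∈ S.map ι, v ∈ A := by
    simp only [Finset.forall_mem_map]
    exact fun x _ => hι x
  have hdisjS : Disjoint X (S.map ι) := by
    rw [Finset.disjoint_left]
    exact fun v hv hv' => hAX v (hS v hv') hv
  have hdisj𝒟 : Disjoint 𝒞 (𝒟.map (Finset.mapEmbedding ι).toEmbedding) := by
    rw [Finset.disjoint_left]
    intro C hC hC'
    obtain ⟨D, hD, rfl⟩ := Finset.mem_map.1 hC'
    obtain ⟨v, hv⟩ := (hB.odd D hD).pos |> Finset.card_pos.1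
    exact hA𝒞 _ hC (ι v) (Finset.mem_map_of_mem ι hv) (hι v)
  refine ⟨X ∪ S.map ι, 𝒞 ∪ 𝒟.map (Finset.mapEmbedding ι).toEmbedding, ?_, ?_, ?_, ?_⟩
  · have hmem : ∀ C, C ∈ 𝒞 ∪ 𝒟.map (Finset.mapEmbedding ι).toEmbedding ↔
        C ∈ 𝒞 ∨ ∃ D ∈ 𝒟, D.map ι = C := by
      intro C
      simp [Finset.mapEmbedding_apply]
    refine ⟨?_, ?_, ?_, ?_, ?_⟩
    · intro C hC
      obtain hC | ⟨D, hD, rfl⟩ := (hmem C).1 hC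
      · exact h.odd C hC
      · simpa using hB.odd D hD
    · intro C hC v hv hvX
      rw [Finset.mem_union] at hvX
      obtain hC | ⟨D, hD, rfl⟩ := (hmem C).1 hC
      · exact hvX.elim (h.notMem C hC v hv) fun hvS => hA𝒞 C hC v hv (hS v hvS)
      · obtain ⟨w, hw, rfl⟩ := Finset.mem_map.1 hv
        refine hvX.elim (hAX _ (hι w)) fun hvS => hB.notMem D hD w hw ?_
        simpa using hvS
    · intro C hC D hD v hvC hvD
      obtain hC | ⟨C, hC', rfl⟩ := (hmem C).1 hC <;> obtain hD | ⟨D, hD', rfl⟩ := (hmem D).1 hD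
      · exact h.eq_of_mem C hC D hD v hvC hvD
      · obtain ⟨w, hw, rfl⟩ := Finset.mem_map.1 hvD
        exact absurd (hι w) (hA𝒞 C hC _ hvC)
      · obtain ⟨w, hw, rfl⟩ := Finset.mem_map.1 hvC
        exact absurd (hι w) (hA𝒞 D hD _ hvD)
      · obtain ⟨w, hw, rfl⟩ := Finset.mem_map.1 hvC
        rw [hB.eq_of_mem C hC' D hD' w hw (by simpa using hvD)]
    · intro C hC u hu v huv
      rw [Finset.mem_union]
      obtain hC | ⟨D, hD, rfl⟩ := (hmem C).1 hC
      · have := h.closed C hC u hu v huv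
        tauto
      · obtain ⟨w, hw, rfl⟩ := Finset.mem_map.1 hu
        obtain hvA | hvX := hA _ (hι w) v huv
        · refine (hB.closed D hD w hw ⟨v, hvA⟩ huv).imp (fun hv => ?_) fun hv => Or.inr ?_
          · exact Finset.mem_map.2 ⟨_, hv, rfl⟩
          · exact Finset.mem_map.2 ⟨_, hv, rfl⟩
        · exact Or.inr (Or.inl hvX)
    · intro C hC
      obtain hC | ⟨D, hD, rfl⟩ := (hmem C).1 hC
      · exact h.conn C hC
      · simp only [Finset.forall_mem_map]
        intro p c hc hpc hp v hv
        exact hB.conn D hD (fun x => p (ι x)) c hc hpc (fun u hu hpu w hw huw =>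
          hp u hu hpu w hw huw) v hv
  · exact Finset.card_le_card Finset.subset_union_left
  all_goals
    rw [Finset.card_union_of_disjoint hdisjS, Finset.card_union_of_disjoint hdisj𝒟,
      Finset.card_map, Finset.card_map]
    grind

open Classical in
theorem exists_isBarrier_maximal [Fintype V] (G : SimpleGraph V) :
    ∃ X 𝒞, IsBarrier_s2 G X 𝒞 ∧
      (∀ X' 𝒞', IsBarrier_s2 G X' 𝒞' → 𝒞'.card + X.card ≤ 𝒞.card + X'.card) ∧
      (∀ X' 𝒞', IsBarrier_s2 G X' 𝒞' → 𝒞'.card + X.card = 𝒞.card + X'.card → X'.card ≤ X.card) := by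
  have hempty : IsBarrier_s2 G ∅ ∅ := by constructor <;> simp
  obtain ⟨⟨X, 𝒞⟩, hX, hmax⟩ := Finset.exists_max_image
    (Finset.univ.filter fun p : Finset V × Finset (Finset V) => IsBarrier_s2 G p.1 p.2)
    (fun p => ((p.2.card : ℤ) - p.1.card) * (Fintype.card V + 1) + p.1.card)
    ⟨(∅, ∅), by simpa using hempty⟩
  simp only [Finset.mem_filter, Finset.mem_univ, true_and, Prod.forall] at hX hmax
  refine ⟨X, 𝒞, hX, fun X' 𝒞' h' => ?_, fun X' 𝒞' h' heq => ?_⟩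
  · by_contra! hlt
    have h1 := hmax X' 𝒞' h'
    have h2 : X.card ≤ Fintype.card V := Finset.card_le_univ X
    zify at hlt h2
    nlinarith
  · have h1 := hmax X' 𝒞' h'
    have h2 : (𝒞'.card : ℤ) - X'.card = 𝒞.card - X.card := by
      zify at heq
      linarith
    rw [h2] at h1
    simpa using h1

open Classical in
/-- There is a barrier `(X, 𝒞)` all of whose components are hypomatchable, such that the remaining
vertices can be matched among themselves and `(X, 𝒞)` has the largest possible deficiency. -/
theorem exists_isBarrier_hypomatchable [Fintype V] (G : SimpleGraph V) :
    ∃ X 𝒞, IsBarrier_s2 G X 𝒞 ∧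
      (∀ X' 𝒞', IsBarrier_s2 G X' 𝒞' → 𝒞'.card + X.card ≤ 𝒞.card + X'.card) ∧
      (∀ C ∈ 𝒞, ∀ u ∈ C, ∃ M : G.Subgraph, M.IsMatching ∧ M.verts = (C.erase u : Finset V)) ∧
      ∃ M : G.Subgraph, M.IsMatching ∧ M.verts = {v | v ∉ X ∧ ∀ C ∈ 𝒞, v ∉ C} := by
  obtain ⟨X, 𝒞, hB, hdef, hmax⟩ := exists_isBarrier_maximal G
  refine ⟨X, 𝒞, hB, hdef, fun C hC u hu => ?_, ?_⟩
  · by_contra hno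
    have hsub := hB.subset (Finset.erase_subset C 𝒞)
    have hne : ∀ D ∈ 𝒞.erase C, ∀ v ∈ D, v ∉ C := fun D hD v hv hv' =>
      (Finset.mem_erase.1 hD).1
        (hB.eq_of_mem D (Finset.mem_of_mem_erase hD) C hC v hv hv')
    obtain ⟨X', 𝒞', hB', hX', -, hev⟩ := (hsub.insert (z := u) fun D hD huD =>
      hne D hD u huD hu).exists_extend (A := C.erase u) (by
        intro v hv
        have := hB.notMem C hC v
        grind) (by
        intro D hD v hv
        have := hne D hD v hv
        grind) (by
        intro w hw v hwv
        have := hB.closed C hC w (Finset.mem_of_mem_erase hw) v hwv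
        grind) hno
    have hodd := hB.odd C hC
    have hcard := Finset.card_erase_add_one hu
    have hcard𝒞 := Finset.card_erase_add_one hC
    have hcardX := Finset.card_insert_of_notMem (hB.notMem C hC u hu)
    have heven : Even (C.erase u).card := by grind
    have h1 := hev heven
    have h2 := hdef X' 𝒞' hB'
    have h3 := hmax X' 𝒞' hB' (by omega)
    omega
  · by_contra hno
    let R : Finset V := Finset.univ.filter fun v => v ∉ X ∧ ∀ C ∈ 𝒞, v ∉ C
    obtain ⟨X', 𝒞', hB', -, hlt, -⟩ := hB.exists_extend (A := R) (by simp +contextual [R])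
      (by
        intro C hC v hv hvR
        exact (Finset.mem_filter.1 hvR).2.2 C hC hv)
      (by
        intro u hu v huv
        by_contra! hv
        obtain ⟨hvR, hvX⟩ := hv
        have : ∃ C ∈ 𝒞, v ∈ C := by
          by_contra! hvC
          exact hvR (Finset.mem_filter.2 ⟨Finset.mem_univ v, hvX, hvC⟩)
        obtain ⟨C, hC, hvC⟩ := this
        obtain ⟨-, huX, huC⟩ := Finset.mem_filter.1 hu
        exact (hB.closed C hC v hvC u huv.symm).elim (huC C hC) huX)
      (by simpa [R] using hno)
    have := hdef X' 𝒞' hB'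
    omega

end Barriers

section Assembly

theorem hypomatchable_of_range_eq {V W : Type*} {G : SimpleGraph V} {G' : SimpleGraph W}
    {A : Set V} (hA : ∀ u ∈ A, ∃ M : G.Subgraph, M.IsMatching ∧ M.verts = A \ {u})
    (e : G' ↪g G) (he : Set.range e = A) : Hypomatchable G' := by
  intro u
  obtain ⟨M, hM, hv⟩ := hA (e u) (he ▸ ⟨u, rfl⟩)
  refine hM.exists_isPerfectMatching_of_range
    ((Embedding.induce (G := G') ({u}ᶜ : Set W)).trans e) (hv.trans ?_)
  change _ = Set.range (e ∘ Subtype.val)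
  rw [Set.range_comp, Subtype.range_coe, Set.image_compl_eq_range_sdiff_image e.injective,
    Set.image_singleton, he]

variable {V : Type} {G : SimpleGraph V}

theorem IsBarrier_s2.connectedComponentMk_eq_iff {X : Finset V} {𝒞 : Finset (Finset V)}
    (h : IsBarrier_s2 G X 𝒞) {C : Finset V} (hC : C ∈ 𝒞) {v : V} (hv : v ∈ C)
    (hv' : v ∈ (X : Set V)ᶜ) {w : V} (hw' : w ∈ (X : Set V)ᶜ) :
    (G.induce (X : Set V)ᶜ).connectedComponentMk ⟨w, hw'⟩ =
      (G.induce (X : Set V)ᶜ).connectedComponentMk ⟨v, hv'⟩ ↔ w ∈ C := by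
  constructor
  · intro hwv
    have aux : ∀ x y, (G.induce (X : Set V)ᶜ).Reachable x y → x.1 ∈ C → y.1 ∈ C := by
      rintro x y ⟨q⟩
      induction q with
      | nil => exact id
      | @cons x y z hxy q ih =>
        exact fun hx => ih ((h.closed C hC _ hx _ hxy).resolve_right y.2)
    exact aux _ _ (ConnectedComponent.exact hwv).symm hv
  · intro hw
    refine h.conn C hC (fun w => ∀ hw' : w ∈ (X : Set V)ᶜ,
      (G.induce (X : Set V)ᶜ).connectedComponentMk ⟨w, hw'⟩ =
        (G.induce (X : Set V)ᶜ).connectedComponentMk ⟨v, hv'⟩) v hv (fun _ => rfl) ?_ w hw hw'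
    intro x hx hxv y hy hxy hy'
    rw [← hxv (h.notMem C hC x hx)]
    exact ConnectedComponent.sound (Adj.reachable (G := G.induce (X : Set V)ᶜ) hxy.symm)

theorem IsBarrier_s2.card_le_bF [Finite V] {𝓕 : Set (Σ W : Type, SimpleGraph W)} {X : Finset V}
    {𝒞 : Finset (Finset V)} (h : IsBarrier_s2 G X 𝒞)
    (hhypo : ∀ C ∈ 𝒞, ∀ u ∈ C, ∃ M : G.Subgraph, M.IsMatching ∧ M.verts = (C : Set V) \ {u})
    (htile : ∀ C ∈ 𝒞, ¬ Tileable 𝓕 G (C : Set V)) : 𝒞.card ≤ bF 𝓕 G X := by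
  have hne : ∀ C ∈ 𝒞, C.Nonempty := fun C hC => Finset.card_pos.1 (h.odd C hC).pos
  choose c hc using hne
  have hcX : ∀ C hC, c C hC ∈ (X : Set V)ᶜ := fun C hC => h.notMem C hC _ (hc C hC)
  have hrange : ∀ C (hC : C ∈ 𝒞), Set.range ((Embedding.induce (G := G.induce (X : Set V)ᶜ)
      ((G.induce (X : Set V)ᶜ).connectedComponentMk ⟨c C hC, hcX C hC⟩).supp).trans
        (Embedding.induce (G := G) (X : Set V)ᶜ)) = C := by
    intro C hC
    ext v
    constructor
    · rintro ⟨⟨⟨w, hw⟩, hwC⟩, rfl⟩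
      exact (h.connectedComponentMk_eq_iff hC (hc C hC) (hcX C hC) hw).1 hwC
    · intro hv
      have hvX : v ∈ (X : Set V)ᶜ := h.notMem C hC v hv
      exact ⟨⟨⟨v, hvX⟩,
        (h.connectedComponentMk_eq_iff hC (hc C hC) (hcX C hC) hvX).2 hv⟩, rfl⟩
  rw [bF, ← Nat.card_eq_finsetCard 𝒞]
  refine Nat.card_le_card_of_injective (fun C : {C // C ∈ 𝒞} =>
    ⟨(G.induce (X : Set V)ᶜ).connectedComponentMk ⟨c C.1 C.2, hcX C.1 C.2⟩, ?_, ?_⟩) ?_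
  · exact hypomatchable_of_range_eq (hhypo C.1 C.2) _ (hrange C.1 C.2)
  · rintro ⟨F, hF⟩
    have := hF.tileable_range ((Embedding.induce _).trans (Embedding.induce _))
    rw [hrange C.1 C.2] at this
    exact htile C.1 C.2 this
  · rintro ⟨C, hC⟩ ⟨D, hD⟩ hCD
    have hmk := congrArg Subtype.val hCD
    have := (h.connectedComponentMk_eq_iff hD (hc D hD) (hcX D hD) (hcX C hC)).1 hmk
    exact Subtype.ext (h.eq_of_mem C hC D hD _ (hc C hC) this)

open Classical in
/-- An injection of the components of a barrier of largest deficiency into `X` plus as many extra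
points as the deficiency, sending each bad component to a neighbour in `X` and covering `X`. -/
theorem IsBarrier_s2.exists_assignment {X : Finset V} {𝒞 : Finset (Finset V)}
    (h : IsBarrier_s2 G X 𝒞)
    (hdef : ∀ X' 𝒞', IsBarrier_s2 G X' 𝒞' → 𝒞'.card + X.card ≤ 𝒞.card + X'.card)
    {bad : Finset V → Prop}
    (hbad : ∀ X' 𝒞', IsBarrier_s2 G X' 𝒞' → 𝒞' ⊆ 𝒞 → (∀ C ∈ 𝒞', bad C) → 𝒞'.card ≤ X'.card) :
    ∃ φ : {C // C ∈ 𝒞} → V ⊕ Fin (𝒞.card - X.card), Function.Injective φ ∧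
      (∀ C x, φ C = Sum.inl x → x ∈ X ∧ ∃ u ∈ C.1, G.Adj u x) ∧
      (∀ C i, φ C = Sum.inr i → ¬ bad C.1) ∧ ∀ x ∈ X, ∃ C, φ C = Sum.inl x := by
  let N : {C // C ∈ 𝒞} → Finset V := fun C => X.filter fun x => ∃ u ∈ C.1, G.Adj u x
  let t : {C // C ∈ 𝒞} → Finset (V ⊕ Fin (𝒞.card - X.card)) := fun C =>
    (N C).disjSum (if bad C.1 then ∅ else Finset.univ)
  have hXC : X.card ≤ 𝒞.card := by
    simpa using hdef ∅ ∅ (by constructor <;> simp)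
  have hall : ∀ s : Finset {C // C ∈ 𝒞}, s.card ≤ (s.biUnion t).card := by
    intro s
    have hsub : s.map (Function.Embedding.subtype _) ⊆ 𝒞 := by
      intro C hC
      obtain ⟨D, -, rfl⟩ := Finset.mem_map.1 hC
      exact D.2
    have hB : IsBarrier_s2 G (s.biUnion N) (s.map (Function.Embedding.subtype _)) := by
      refine (h.subset hsub).restrict_separator ?_ ?_
      · exact Finset.biUnion_subset.2 fun C _ => Finset.filter_subset _ _
      · intro C hC u hu x hx hux
        obtain ⟨D, hD, rfl⟩ := Finset.mem_map.1 hC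
        exact Finset.mem_biUnion.2 ⟨D, hD, Finset.mem_filter.2 ⟨hx, u, hu, hux⟩⟩
    by_cases hs : ∀ C ∈ s, bad C.1
    · have h1 := hbad _ _ hB hsub (by
        simp only [Finset.forall_mem_map]
        exact hs)
      rw [Finset.card_map] at h1
      refine h1.trans ?_
      rw [← Finset.card_map Function.Embedding.inl]
      refine Finset.card_le_card fun y hy => ?_
      obtain ⟨x, hx, rfl⟩ := Finset.mem_map.1 hy
      obtain ⟨C, hC, hxC⟩ := Finset.mem_biUnion.1 hx
      exact Finset.mem_biUnion.2 ⟨C, hC, Finset.inl_mem_disjSum.2 hxC⟩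
    · push Not at hs
      obtain ⟨C₀, hC₀, hgood⟩ := hs
      have h1 := hdef _ _ hB
      rw [Finset.card_map] at h1
      have h2 : ((s.biUnion N).disjSum
          (Finset.univ : Finset (Fin (𝒞.card - X.card)))).card ≤ (s.biUnion t).card := by
        refine Finset.card_le_card fun y hy => ?_
        obtain ⟨x, hx, rfl⟩ | ⟨i, -, rfl⟩ := Finset.mem_disjSum.1 hy
        · obtain ⟨C, hC, hxC⟩ := Finset.mem_biUnion.1 hx
          exact Finset.mem_biUnion.2 ⟨C, hC, Finset.inl_mem_disjSum.2 hxC⟩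
        · exact Finset.mem_biUnion.2 ⟨C₀, hC₀, Finset.inr_mem_disjSum.2 (by simp [hgood])⟩
      rw [Finset.card_disjSum, Finset.card_univ, Fintype.card_fin] at h2
      omega
  obtain ⟨φ, hφ, hφt⟩ := (Finset.all_card_le_biUnion_card_iff_exists_injective t).1 hall
  have hinl : ∀ C x, φ C = Sum.inl x → x ∈ X ∧ ∃ u ∈ C.1, G.Adj u x := by
    intro C x hCx
    have := hφt C
    rw [hCx] at this
    exact Finset.mem_filter.1 (Finset.inl_mem_disjSum.1 this)
  refine ⟨φ, hφ, hinl, ?_, ?_⟩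
  · intro C i hCi hbadC
    have := hφt C
    rw [hCi] at this
    simpa [hbadC] using Finset.inr_mem_disjSum.1 this
  · have hsub : Finset.univ.image φ ⊆ X.disjSum Finset.univ := by
      simp only [Finset.image_subset_iff]
      intro C _
      rcases hC : φ C with x | i
      · exact Finset.inl_mem_disjSum.2 (hinl C x hC).1
      · exact Finset.inr_mem_disjSum.2 (Finset.mem_univ i)
    have heq := Finset.eq_of_subset_of_card_le hsub (by
      rw [Finset.card_image_of_injective _ hφ, Finset.card_disjSum, Finset.card_univ,
        Finset.card_univ, Fintype.card_fin, Fintype.card_coe]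
      omega)
    intro x hx
    have : Sum.inl x ∈ Finset.univ.image φ := heq ▸ Finset.inl_mem_disjSum.2 hx
    simpa using this

end Assembly

/-- If `𝓕` is a set of connected graphs with `P₂ ∈ 𝓕` and `b_𝓕(G - X) ≤ |X|` for all
`X ⊆ V(G)`, then `G` has an `𝓕`-factor. -/
theorem stmt2 (𝓕 : Set (Σ W : Type, SimpleGraph W))
    (hconn : ∀ H ∈ 𝓕, H.2.Connected)
    (hP2 : (⟨Fin 2, pathGraph 2⟩ : Σ W : Type, SimpleGraph W) ∈ 𝓕)
    {V : Type} [Fintype V] (G : SimpleGraph V)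
    (h : ∀ X : Set V, bF 𝓕 G X ≤ Nat.card X) :
    ∃ F, IsFamilyFactor 𝓕 G F := by
  classical
  obtain ⟨X, 𝒞, hB, hdef, hhypo, M, hM, hMv⟩ := exists_isBarrier_hypomatchable G
  have hhypo' : ∀ C ∈ 𝒞, ∀ u ∈ C,
      ∃ M : G.Subgraph, M.IsMatching ∧ M.verts = (C : Set V) \ {u} := by
    simpa only [Finset.coe_erase] using hhypo
  obtain ⟨φ, hφ, hinl, hinr, hsurj⟩ := hB.exists_assignment hdef
    (bad := fun C => ¬ Tileable 𝓕 G (C : Set V)) (fun X' 𝒞' hB' hsub hbad => by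
      refine (hB'.card_le_bF (fun C hC => hhypo' C (hsub hC)) hbad).trans ((h X').trans ?_)
      simp)
  let A : Option {C // C ∈ 𝒞} → Set V := fun o => o.elim {v | v ∉ X ∧ ∀ C ∈ 𝒞, v ∉ C}
    fun C => {v | v ∈ C.1 ∨ φ C = Sum.inl v}
  have hA : ∀ o, Tileable 𝓕 G (A o) := by
    rintro (_ | C)
    · change Tileable 𝓕 G {v | v ∉ X ∧ ∀ C ∈ 𝒞, v ∉ C}
      rw [← hMv]
      exact hM.tileable hP2
    · rcases hC : φ C with x | i
      · obtain ⟨hxX, u, hu, hux⟩ := hinl C x hC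
        obtain ⟨N, hN, hNv⟩ := hhypo' C.1 C.2 u hu
        have hxC : x ∉ C.1 := fun hx => hB.notMem C.1 C.2 x hx hxX
        have hdisj : Disjoint N.support (G.subgraphOfAdj hux).support := by
          rw [hN.support_eq_verts, (Subgraph.IsMatching.subgraphOfAdj hux).support_eq_verts, hNv,
            Set.disjoint_left]
          rintro v ⟨hvC, hvu⟩ (rfl | rfl)
          exacts [hvu rfl, hxC hvC]
        convert (hN.sup (Subgraph.IsMatching.subgraphOfAdj hux) hdisj).tileable hP2
        rw [Subgraph.verts_sup, hNv]
        ext v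
        simp only [A, Option.elim, hC, Sum.inl.injEq, Set.mem_ofPred_eq, Set.mem_union,
          Set.mem_sdiff, Finset.mem_coe, Set.mem_singleton_iff, subgraphOfAdj_verts,
          Set.mem_insert_iff]
        grind
      · convert not_not.1 (hinr C i hC)
        ext v
        simp [A, hC]
  have hdisj : ∀ o o' v, v ∈ A o → v ∈ A o' → o = o' := by
    have hnone : ∀ C v, v ∈ A none → v ∉ A (some C) := by
      rintro C v ⟨hvX, hvC⟩ (hv | hv)
      exacts [hvC C.1 C.2 hv, hvX (hinl C v hv).1]
    rintro (_ | C) (_ | D) v hv hv'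
    · rfl
    · exact absurd hv' (hnone D v hv)
    · exact absurd hv (hnone C v hv')
    · congr 1
      obtain hv | hv := hv <;> obtain hv' | hv' := hv'
      · exact Subtype.ext (hB.eq_of_mem C.1 C.2 D.1 D.2 v hv hv')
      · exact absurd (hinl D v hv').1 (hB.notMem C.1 C.2 v hv)
      · exact absurd (hinl C v hv).1 (hB.notMem D.1 D.2 v hv')
      · exact hφ (hv.trans hv'.symm)
  have hcover : ⋃ o, A o = Set.univ := by
    refine Set.eq_univ_of_forall fun v => Set.mem_iUnion.2 ?_
    by_cases hvX : v ∈ X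
    · obtain ⟨C, hC⟩ := hsurj v hvX
      exact ⟨some C, Or.inr hC⟩
    · by_cases hvC : ∃ C ∈ 𝒞, v ∈ C
      · obtain ⟨C, hC, hv⟩ := hvC
        exact ⟨some ⟨C, hC⟩, Or.inl hv⟩
      · push Not at hvC
        exact ⟨none, hvX, hvC⟩
  exact (hcover ▸ Tileable.iUnion hA hdisj).exists_isFamilyFactor hconn
end

section
/- Let k ≥ 3 be an integer. Then every hypomatchable graph G of order at least 2k+1 having no {P₂, P_{2k+1}}-factor contains a set X ⊆ V(G) with |X| ≥ 5 such that ∑_{0≤j≤k−1} c_{2j+1}(G−X) ≥ (1/k²)·|X|. (In the paper's terminology: (1/k², 5) is a (k, {P₂, P_{2k+1}})-good pair.) -/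
open SimpleGraph

/-- A perfect matching of `G - u` gives an involution fixing exactly `u` and moving every other
vertex along an edge. -/
lemma Hypomatchable.exists_involution {V : Type*} {G : SimpleGraph V} (h : Hypomatchable G)
    (u : V) : ∃ f : V → V, f u = u ∧ (∀ v, f (f v) = v) ∧ ∀ v, v ≠ u → G.Adj v (f v) := by
  classical
  obtain ⟨M, hM⟩ := h u
  rw [Subgraph.isPerfectMatching_iff] at hM
  choose g hg huniq using hM
  have hg' : ∀ v, g (g v) = v := fun v => (huniq _ _ (hg v).symm).symm
  refine ⟨fun v => if hv : v = u then u else g ⟨v, hv⟩, by simp, fun v => ?_, fun v hv => ?_⟩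
  · by_cases hv : v = u
    · simp [hv]
    · have : ((g ⟨v, hv⟩ : _) : V) ≠ u := (g ⟨v, hv⟩).2
      simp [hv, this, hg']
  · simpa [hv] using M.adj_sub (hg ⟨v, hv⟩)

/-- A vertex set closed under adjacency that carries an induced path is a component isomorphic to
that path. -/
lemma nonempty_induce_supp_iso_pathGraph {V : Type*} {F : SimpleGraph V} {m : ℕ}
    (q : Fin (m + 1) → V) (hq : Function.Injective q)
    (hadj : ∀ i j, F.Adj (q i) (q j) ↔ (pathGraph (m + 1)).Adj i j)
    (hclosed : ∀ i b, F.Adj (q i) b → b ∈ Set.range q)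
    (C : F.ConnectedComponent) (i₀ : Fin (m + 1)) (hC : q i₀ ∈ C.supp) :
    Nonempty ((F.induce C.supp) ≃g pathGraph (m + 1)) := by
  have hmk : F.connectedComponentMk (q i₀) = C := hC
  let φ : pathGraph (m + 1) →g F := ⟨q, fun {i j} h => (hadj i j).2 h⟩
  have hsub : ∀ i, q i ∈ C.supp := fun i => by
    have : F.Reachable (q i) (q i₀) := ((pathGraph_connected m).preconnected i i₀).map φ
    rw [ConnectedComponent.mem_supp_iff, ← hmk]
    exact ConnectedComponent.sound this
  have hsup : ∀ v ∈ C.supp, v ∈ Set.range q := fun v hv => by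
    have hr : F.Reachable (q i₀) v := by
      rw [← ConnectedComponent.eq, hmk]
      exact hv.symm
    have key : ∀ {a b : V}, F.Walk a b → a ∈ Set.range q → b ∈ Set.range q := by
      intro a b w
      induction w with
      | nil => exact id
      | cons h _ ih =>
        rintro ⟨i, rfl⟩
        exact ih (hclosed i _ h)
    exact key hr.some ⟨i₀, rfl⟩
  let e : Fin (m + 1) ≃ C.supp := Equiv.ofBijective (fun i => ⟨q i, hsub i⟩)
    ⟨fun i j h => hq (congrArg Subtype.val h),
      fun v => (hsup v v.2).imp fun _ hi => Subtype.ext hi⟩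
  exact ⟨(⟨e, fun {i j} => hadj i j⟩ : pathGraph (m + 1) ≃g F.induce C.supp).symm⟩

/-- In a graph of large minimum degree, paths alternating with respect to a near-perfect matching
can be built greedily. -/
lemma exists_alternating_path {V : Type*} [Fintype V] {G : SimpleGraph V} [DecidableRel G.Adj]
    {u : V} {f : V → V} (hu : f u = u) (hf : ∀ v, f (f v) = v)
    (hfG : ∀ v, v ≠ u → G.Adj v (f v)) {k : ℕ} (hdeg : ∀ v, 2 * k ≤ G.degree v)
    (i : ℕ) (hi : i ≤ k) :
    ∃ p : ℕ → V, p 0 = u ∧ Set.InjOn p (Set.Iic (2 * i)) ∧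
      (∀ j < 2 * i, G.Adj (p j) (p (j + 1))) ∧
      ∀ j ≤ 2 * i, ∃ l ≤ 2 * i, f (p j) = p l := by
  classical
  induction i with
  | zero =>
    refine ⟨fun _ => u, rfl, ?_, by simp, fun j _ => ⟨0, le_rfl, hu⟩⟩
    intro a ha b hb _
    simp only [mul_zero, Set.mem_Iic, nonpos_iff_eq_zero] at ha hb
    rw [ha, hb]
  | succ i ih =>
    obtain ⟨p, hp0, hinj, hadj, hcl⟩ := ih (by omega)
    obtain ⟨x, hxN, hxS⟩ : ∃ x ∈ G.neighborFinset (p (2 * i)),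
        x ∉ (Finset.range (2 * i + 1)).image p := by
      apply Finset.exists_mem_notMem_of_card_lt_card
      have h1 := Finset.card_image_le (s := Finset.range (2 * i + 1)) (f := p)
      have h2 := hdeg (p (2 * i))
      rw [Finset.card_range] at h1
      rw [G.card_neighborFinset_eq_degree]
      omega
    have hx : ∀ j ≤ 2 * i, p j ≠ x := fun j hj h =>
      hxS (Finset.mem_image.2 ⟨j, Finset.mem_range.2 (by omega), h⟩)
    have hfx : ∀ j ≤ 2 * i, p j ≠ f x := fun j hj h => by
      obtain ⟨l, hl, hl'⟩ := hcl j hj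
      rw [h, hf] at hl'
      exact hx l hl hl'.symm
    have hxu : x ≠ u := fun h => hx 0 (by omega) (hp0.trans h.symm)
    have hxf : G.Adj x (f x) := hfG x hxu
    have hpx : G.Adj (p (2 * i)) x := by simpa using hxN
    let p' : ℕ → V := fun n => if n ≤ 2 * i then p n else if n = 2 * i + 1 then x else f x
    have hp' : ∀ j ≤ 2 * i, p' j = p j := fun j hj => if_pos hj
    have hp1 : p' (2 * i + 1) = x := by simp [p']
    have hp2 : p' (2 * i + 2) = f x := by simp [p']
    have hcases : ∀ j ≤ 2 * (i + 1), j ≤ 2 * i ∨ j = 2 * i + 1 ∨ j = 2 * i + 2 := by omega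
    refine ⟨p', by rw [hp' 0 (by omega), hp0], ?_, ?_, ?_⟩
    · intro a ha b hb hab
      rcases hcases a ha with ha | rfl | rfl <;> rcases hcases b hb with hb | rfl | rfl <;>
        try simp only [hp1, hp2] at hab ⊢
      · rw [hp' a ha, hp' b hb] at hab
        exact hinj ha hb hab
      · exact absurd ((hp' a ha).symm.trans hab) (hx a ha)
      · exact absurd ((hp' a ha).symm.trans hab) (hfx a ha)
      · exact absurd ((hp' b hb).symm.trans hab.symm) (hx b hb)
      · exact absurd hab hxf.ne
      · exact absurd ((hp' b hb).symm.trans hab.symm) (hfx b hb)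
      · exact absurd hab.symm hxf.ne
    · intro j hj
      rcases hcases j hj.le with h | rfl | rfl
      · rcases h.lt_or_eq with h' | rfl
        · rw [hp' j h, hp' (j + 1) h']
          exact hadj j h'
        · rw [hp1, hp' _ le_rfl]
          exact hpx
      · rw [hp1, hp2]
        exact hxf
      · omega
    · intro j hj
      rcases hcases j hj with h | rfl | rfl
      · obtain ⟨l, hl, hl'⟩ := hcl j h
        exact ⟨l, by omega, by rw [hp' j h, hp' l hl, hl']⟩
      · exact ⟨2 * i + 2, by omega, by rw [hp1, hp2]⟩
      · exact ⟨2 * i + 1, by omega, by rw [hp1, hp2, hf]⟩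

/-- An alternating path on `2k+1` vertices together with the remaining matching edges is a
`{P₂, P_{2k+1}}`-factor. -/
lemma exists_isP2P2k1Factor {V : Type*} {G : SimpleGraph V} {u : V} {f : V → V}
    (hf : ∀ v, f (f v) = v) (hfG : ∀ v, v ≠ u → G.Adj v (f v)) {k : ℕ} {p : ℕ → V}
    (hp0 : p 0 = u) (hinj : Set.InjOn p (Set.Iic (2 * k)))
    (hadj : ∀ j < 2 * k, G.Adj (p j) (p (j + 1)))
    (hcl : ∀ j ≤ 2 * k, ∃ l ≤ 2 * k, f (p j) = p l) :
    ∃ F, IsP2P2k1Factor G k F := by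
  let S : Set V := p '' Set.Iic (2 * k)
  have hSu : u ∈ S := ⟨0, by simp, hp0⟩
  have hSf : ∀ v, f v ∈ S → v ∈ S := by
    rintro v ⟨j, hj, hjv⟩
    obtain ⟨l, hl, hl'⟩ := hcl j hj
    exact ⟨l, hl, by rw [← hl', hjv, hf]⟩
  have hne : ∀ v, v ∉ S → G.Adj v (f v) := fun v hv => hfG v fun h => hv (h ▸ hSu)
  let F : SimpleGraph V :=
    { Adj := fun a b => (∃ i < 2 * k, (a = p i ∧ b = p (i + 1)) ∨ (b = p i ∧ a = p (i + 1))) ∨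
        (a ∉ S ∧ b ∉ S ∧ b = f a)
      symm := ⟨by
        rintro a b (⟨i, hi, h⟩ | ⟨ha, hb, h⟩)
        · exact Or.inl ⟨i, hi, h.symm⟩
        · exact Or.inr ⟨hb, ha, by rw [h, hf]⟩⟩
      loopless := ⟨by
        rintro a (⟨i, hi, ⟨h, h'⟩ | ⟨h, h'⟩⟩ | ⟨ha, _, h⟩)
        · exact (hadj i hi).ne (h.symm.trans h')
        · exact (hadj i hi).ne (h.symm.trans h')
        · exact (hne a ha).ne h⟩ }
  have hmem : ∀ i ≤ 2 * k, p i ∈ S := fun i hi => ⟨i, hi, rfl⟩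
  refine ⟨F, ?_, fun C => ?_⟩
  · rintro a b (⟨i, hi, ⟨rfl, rfl⟩ | ⟨rfl, rfl⟩⟩ | ⟨ha, _, rfl⟩)
    · exact hadj i hi
    · exact (hadj i hi).symm
    · exact hne a ha
  · obtain ⟨v, hv⟩ := C.nonempty_supp
    by_cases hvS : v ∈ S
    · right
      obtain ⟨i₀, hi₀, rfl⟩ := hvS
      have hi₀' : i₀ ≤ 2 * k := hi₀
      refine nonempty_induce_supp_iso_pathGraph (fun i : Fin (2 * k + 1) => p i) ?_ ?_ ?_ C
        ⟨i₀, by omega⟩ hv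
      · intro i j h
        exact Fin.ext (hinj (Nat.lt_succ_iff.1 i.2) (Nat.lt_succ_iff.1 j.2) h)
      · intro i j
        rw [pathGraph_adj]
        have hi := Nat.lt_succ_iff.1 i.2
        have hj := Nat.lt_succ_iff.1 j.2
        constructor
        · rintro (⟨l, hl, ⟨h, h'⟩ | ⟨h, h'⟩⟩ | ⟨h, _, _⟩)
          · have e1 := hinj hi (Set.mem_Iic.2 hl.le) h
            have e2 := hinj hj (Set.mem_Iic.2 hl) h'
            omega
          · have e1 := hinj hj (Set.mem_Iic.2 hl.le) h
            have e2 := hinj hi (Set.mem_Iic.2 hl) h'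
            omega
          · exact absurd (hmem i hi) h
        · rintro (h | h)
          · exact Or.inl ⟨i, by omega, Or.inl ⟨rfl, by rw [h]⟩⟩
          · exact Or.inl ⟨j, by omega, Or.inr ⟨rfl, by rw [h]⟩⟩
      · rintro i b (⟨l, hl, ⟨_, rfl⟩ | ⟨rfl, _⟩⟩ | ⟨h, _, _⟩)
        · exact ⟨⟨l + 1, by omega⟩, rfl⟩
        · exact ⟨⟨l, by omega⟩, rfl⟩
        · exact absurd (hmem i (Nat.lt_succ_iff.1 i.2)) h
    · left
      have hfv : f v ∉ S := fun h => hvS (hSf v h)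
      have hvf : v ≠ f v := (hne v hvS).ne
      have hFv : F.Adj v (f v) := Or.inr ⟨hvS, hfv, rfl⟩
      have hout : ∀ a b, a ∉ S → F.Adj a b → b = f a := by
        rintro a b ha (⟨l, hl, ⟨rfl, _⟩ | ⟨_, rfl⟩⟩ | ⟨_, _, h⟩)
        · exact absurd (hmem l hl.le) ha
        · exact absurd (hmem (l + 1) hl) ha
        · exact h
      refine nonempty_induce_supp_iso_pathGraph (m := 1) ![v, f v] ?_ ?_ ?_ C 0 (by simpa using hv)
      · intro i j h
        fin_cases i <;> fin_cases j <;> simp_all [hvf.symm]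
      · intro i j
        rw [pathGraph_adj]
        fin_cases i <;> fin_cases j <;> simp [hFv, hFv.symm]
      · intro i b h
        fin_cases i
        · exact ⟨1, (hout v b hvS h).symm⟩
        · exact ⟨0, ((hout (f v) b hfv h).trans (hf v)).symm⟩

/-- A vertex all of whose neighbours lie in `X` is a component of order one of `G - X`. -/
lemma one_le_cComp_one {V : Type*} [Finite V] {G : SimpleGraph V} {X : Set V} {v : V}
    (hv : v ∉ X) (hX : G.neighborSet v ⊆ X) : 1 ≤ cComp G X 1 := by
  have hsupp : ((G.induce Xᶜ).connectedComponentMk ⟨v, hv⟩).supp = {⟨v, hv⟩} := by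
    ext w
    rw [ConnectedComponent.mem_supp_iff, ConnectedComponent.eq, Set.mem_singleton_iff]
    refine ⟨fun h => ?_, fun h => h ▸ Reachable.refl _⟩
    obtain ⟨W⟩ := h.symm
    cases W with
    | nil => rfl
    | @cons _ w _ h _ => exact absurd (hX h) w.2
  have : Nonempty {C : (G.induce Xᶜ).ConnectedComponent // Nat.card C.supp = 1} :=
    ⟨⟨(G.induce Xᶜ).connectedComponentMk ⟨v, hv⟩, by rw [hsupp]; simp⟩⟩
  exact Nat.card_pos

/-- For `k ≥ 3`, every hypomatchable graph `G` of order at least `2k+1` having no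
`{P₂, P_{2k+1}}`-factor contains a set `X ⊆ V(G)` with `|X| ≥ 5` such that
`∑_{0 ≤ j ≤ k-1} c_{2j+1}(G - X) ≥ (1/k²)·|X|`. -/
theorem stmt3 (k : ℕ) (hk : 3 ≤ k) {V : Type} [Fintype V] (G : SimpleGraph V)
    (hhypo : Hypomatchable G) (horder : 2 * k + 1 ≤ Nat.card V)
    (hno : ¬ ∃ F, IsP2P2k1Factor G k F) :
    ∃ X : Set V, 5 ≤ Nat.card X ∧
      (1 / (k : ℝ) ^ 2) * Nat.card X ≤ ∑ j ∈ Finset.range k, (cComp G X (2 * j + 1) : ℝ) := by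
  classical
  obtain ⟨v, hv⟩ : ∃ v, G.degree v < 2 * k := by
    by_contra! hdeg
    have : Nonempty V := (Nat.card_pos_iff.1 (by omega : 0 < Nat.card V)).1
    obtain ⟨f, hu, hf, hfG⟩ := hhypo.exists_involution (Classical.arbitrary V)
    obtain ⟨p, hp0, hinj, hadj, hcl⟩ := exists_alternating_path hu hf hfG hdeg k le_rfl
    exact hno (exists_isP2P2k1Factor hf hfG hp0 hinj hadj hcl)
  rw [Nat.card_eq_fintype_card] at horder
  obtain ⟨X, hNX, hXv, hXcard⟩ := Finset.exists_subsuperset_card_eq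
    (s := G.neighborFinset v) (t := Finset.univ.erase v) (n := 2 * k - 1)
    (fun w hw => by
      have : G.Adj v w := by simpa using hw
      simp [this.ne'])
    (by rw [G.card_neighborFinset_eq_degree]; omega)
    (by rw [Finset.card_erase_of_mem (Finset.mem_univ v), Finset.card_univ]; omega)
  have hcard : Nat.card (X : Set V) = 2 * k - 1 := by simp [hXcard]
  have hone : 1 ≤ cComp G (X : Set V) 1 :=
    one_le_cComp_one (v := v) (fun h => by simpa using hXv h)
      (fun w hw => hNX (by simpa using hw))
  refine ⟨X, by omega, ?_⟩
  rw [hcard]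
  have hk2 : ((2 * k - 1 : ℕ) : ℝ) ≤ (k : ℝ) ^ 2 := by
    have : 2 * k - 1 ≤ k ^ 2 := by
      have : 2 * k ≤ k ^ 2 := by nlinarith
      omega
    exact_mod_cast this
  calc 1 / (k : ℝ) ^ 2 * ((2 * k - 1 : ℕ) : ℝ) ≤ 1 := by
        rw [one_div_mul_eq_div]
        exact div_le_one_of_le₀ hk2 (by positivity)
    _ ≤ (cComp G (X : Set V) (2 * 0 + 1) : ℝ) := by exact_mod_cast hone
    _ ≤ _ := Finset.single_le_sum (f := fun j => (cComp G (X : Set V) (2 * j + 1) : ℝ))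
        (fun _ _ => by positivity) (Finset.mem_range.2 (by omega))
end

section
/- Let k ≥ 1 be an integer, let 𝓕 be a set of connected graphs with P₂ ∈ 𝓕, and let (ε, λ) be a (k, 𝓕)-good pair with ε ≤ 1. If a finite simple graph G satisfies ∑_{0≤j≤k−1} c_{2j+1}(G−X) ≤ (λε/(λ+1))·|X| for all X ⊆ V(G), then G has an 𝓕-factor. -/
open SimpleGraph

/-- `(ε, λ)` is a `(k, 𝓕)`-good pair: every hypomatchable graph of order at least `2k+1`
with no `𝓕`-factor has a set `X` of vertices with `|X| ≥ λ` such that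
`∑_{0 ≤ j ≤ k-1} c_{2j+1}(G - X) ≥ ε·|X|`. -/
def IsGoodPair (k : ℕ) (𝓕 : Set (Σ W : Type, SimpleGraph W)) (ε : ℝ) (lam : ℕ) : Prop :=
  0 < ε ∧
  ∀ (V : Type) (_ : Fintype V) (G : SimpleGraph V), Hypomatchable G →
    2 * k + 1 ≤ Nat.card V → (¬ ∃ F, IsFamilyFactor 𝓕 G F) →
    ∃ X : Set V, lam ≤ Nat.card X ∧
      ε * Nat.card X ≤ ∑ j ∈ Finset.range k, (cComp G X (2 * j + 1) : ℝ)


namespace SimpleGraph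

variable {V W : Type*}

/-- `D` is the vertex set of a connected component of `G - X`. -/
structure IsDeletionComponent (G : SimpleGraph V) (X D : Set V) : Prop where
  nonempty : D.Nonempty
  disjoint : Disjoint D X
  mem_of_adj : ∀ a ∈ D, ∀ b ∉ X, G.Adj a b → b ∈ D
  eq_of_subset : ∀ E ⊆ D, E.Nonempty → (∀ a ∈ E, ∀ b ∈ D, G.Adj a b → b ∈ E) → E = D

namespace IsDeletionComponent

variable {G : SimpleGraph V} {X Y C D : Set V}

lemma eq_of_mem (hC : G.IsDeletionComponent X C) (hD : G.IsDeletionComponent X D) {v : V}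
    (hvC : v ∈ C) (hvD : v ∈ D) : C = D := by
  have key : ∀ {C D : Set V}, G.IsDeletionComponent X C → G.IsDeletionComponent X D →
      v ∈ C → v ∈ D → C ∩ D = C := fun hC hD hvC hvD ↦
    hC.eq_of_subset _ Set.inter_subset_left ⟨v, hvC, hvD⟩ fun a ha b hb hab ↦
      ⟨hb, hD.mem_of_adj a ha.2 b (Set.disjoint_left.1 hC.disjoint hb) hab⟩
  rw [← key hC hD hvC hvD, Set.inter_comm, key hD hC hvD hvC]

lemma congr_deleted (hD : G.IsDeletionComponent X D) (hdisj : Disjoint D Y)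
    (hadj : ∀ a ∈ D, ∀ b ∉ Y, G.Adj a b → b ∈ D) : G.IsDeletionComponent Y D :=
  ⟨hD.nonempty, hdisj, hadj, hD.eq_of_subset⟩

lemma subset_of_union_compl (hD : G.IsDeletionComponent (X ∪ Cᶜ) D) : D ⊆ C := fun v hv ↦ by
  by_contra h
  exact Set.disjoint_left.1 hD.disjoint hv (.inr h)

/-- A component of `G[C] - X` is a component of `G - Y` provided that `C` has no edges leaving it
in `G - Y` and `X` and `Y` agree on `C`. -/
lemma of_union_compl (hD : G.IsDeletionComponent (X ∪ Cᶜ) D)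
    (hC : ∀ a ∈ C, ∀ b ∉ Y, G.Adj a b → b ∈ C) (hYX : Y ∩ C ⊆ X) (hXY : X ⊆ Y) :
    G.IsDeletionComponent Y D := by
  refine hD.congr_deleted (Set.disjoint_left.2 fun v hv hvY ↦ ?_) fun a ha b hb hab ↦ ?_
  · exact Set.disjoint_left.1 hD.disjoint hv (.inl (hYX ⟨hvY, hD.subset_of_union_compl hv⟩))
  · refine hD.mem_of_adj a ha b ?_ hab
    rintro (h | h)
    · exact hb (hXY h)
    · exact h (hC a (hD.subset_of_union_compl ha) b hb hab)

end IsDeletionComponent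

variable {G : SimpleGraph V} {H : SimpleGraph W}

lemma Embedding.isDeletionComponent_image_supp (e : H ↪g G) {X : Set V} (hX : Set.range e = Xᶜ)
    (c : H.ConnectedComponent) : G.IsDeletionComponent X (e '' c.supp) := by
  refine ⟨c.nonempty_supp.image _, ?_, ?_, ?_⟩
  · rw [Set.disjoint_left]
    rintro _ ⟨w, -, rfl⟩
    exact (hX ▸ Set.mem_range_self w : e w ∈ Xᶜ)
  · rintro _ ⟨w, hw, rfl⟩ b hb hab
    obtain ⟨z, rfl⟩ : b ∈ Set.range e := hX ▸ hb
    exact ⟨z, (c.mem_supp_congr_adj (e.map_adj_iff.1 hab)).1 hw, rfl⟩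
  · rintro E hE ⟨x, hx⟩ hadj
    refine hE.antisymm ?_
    obtain ⟨w, hw, rfl⟩ := hE hx
    rintro _ ⟨z, hz, rfl⟩
    have hwz : H.Reachable w z := ConnectedComponent.exact (hw.trans hz.symm)
    obtain ⟨p⟩ := hwz
    induction p with
    | nil => exact hx
    | cons h p ih =>
      have hv := (c.mem_supp_congr_adj h).1 hw
      exact ih hv (hadj _ hx _ ⟨_, hv, rfl⟩ (e.map_adj_iff.2 h)) hz

lemma Embedding.isDeletionComponent_iff (e : H ↪g G) {X : Set V} (hX : Set.range e = Xᶜ)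
    {D : Set V} : G.IsDeletionComponent X D ↔ ∃ c : H.ConnectedComponent, e '' c.supp = D := by
  refine ⟨fun hD ↦ ?_, ?_⟩
  · obtain ⟨v, hv⟩ := hD.nonempty
    obtain ⟨w, rfl⟩ : v ∈ Set.range e := hX ▸ Set.disjoint_left.1 hD.disjoint hv
    exact ⟨H.connectedComponentMk w, (e.isDeletionComponent_image_supp hX _).eq_of_mem hD
      ⟨w, rfl, rfl⟩ hv⟩
  · rintro ⟨c, rfl⟩
    exact e.isDeletionComponent_image_supp hX c

lemma Embedding.ncard_isDeletionComponent (e : H ↪g G) {X : Set V} (hX : Set.range e = Xᶜ)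
    (p : ℕ → Prop) : {D | G.IsDeletionComponent X D ∧ p D.ncard}.ncard =
      {c : H.ConnectedComponent | p c.supp.ncard}.ncard := by
  have hinj : Function.Injective fun c : H.ConnectedComponent ↦ e '' c.supp := fun c d hcd ↦
    ConnectedComponent.supp_injective (e.injective.image_injective hcd)
  rw [← Set.ncard_image_of_injective _ hinj]
  congr 1
  ext D
  simp only [Set.mem_ofPred_eq, e.isDeletionComponent_iff hX, Set.mem_image]
  constructor
  · rintro ⟨⟨c, rfl⟩, h⟩
    exact ⟨c, by rwa [Set.ncard_image_of_injective _ e.injective] at h, rfl⟩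
  · rintro ⟨c, h, rfl⟩
    exact ⟨⟨c, rfl⟩, by rwa [Set.ncard_image_of_injective _ e.injective]⟩

lemma exists_isDeletionComponent_mem (G : SimpleGraph V) {X : Set V} {v : V} (hv : v ∉ X) :
    ∃ D, G.IsDeletionComponent X D ∧ v ∈ D :=
  ⟨_, (Embedding.induce Xᶜ).isDeletionComponent_image_supp (G := G) (X := X) Subtype.range_coe
    ((G.induce Xᶜ).connectedComponentMk ⟨v, hv⟩), ⟨v, hv⟩, rfl, rfl⟩

/-- The components of `G - X` of odd order less than `2 * k`. -/
def smallOddComponents (k : ℕ) (G : SimpleGraph V) (X : Set V) : Set (Set V) :=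
  {D | G.IsDeletionComponent X D ∧ Odd D.ncard ∧ D.ncard < 2 * k}

lemma Embedding.ncard_smallOddComponents [Finite V] (e : H ↪g G) {X : Set V} {Y : Set W} (k : ℕ)
    (hX : e '' Yᶜ = Xᶜ) :
    (smallOddComponents k G X).ncard = ∑ j ∈ Finset.range k, cComp H Y (2 * j + 1) := by
  classical
  have hcomp (j : ℕ) : cComp H Y j = {D | G.IsDeletionComponent X D ∧ D.ncard = j}.ncard := by
    rw [(e.comp (Embedding.induce Yᶜ)).ncard_isDeletionComponent (X := X) _ (· = j)]
    · rfl
    · rw [← hX]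
      ext
      simp
  have hfin (s : Set (Set V)) : s.Finite := s.toFinite
  simp_rw [hcomp, Set.ncard_eq_toFinset_card _ (hfin _)]
  rw [← Finset.card_biUnion]
  · congr 1
    ext D
    simp only [smallOddComponents, Set.Finite.mem_toFinset, Set.mem_ofPred_eq, Finset.mem_biUnion,
      Finset.mem_range]
    constructor
    · rintro ⟨h, ⟨j, hj⟩, hlt⟩
      exact ⟨j, by lia, h, hj⟩
    · rintro ⟨j, hj, h, hD⟩
      exact ⟨h, ⟨j, hD⟩, by lia⟩
  · intro i _ j _ hij
    rw [Function.onFun, Finset.disjoint_left]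
    intro D hi hj
    simp only [Set.Finite.mem_toFinset, Set.mem_ofPred_eq] at hi hj
    lia

/-- The components of `G - X` of odd order. -/
def oddDeletionComponents (G : SimpleGraph V) (X : Set V) : Set (Set V) :=
  {D | G.IsDeletionComponent X D ∧ Odd D.ncard}

/-- `S` maximizes the deficiency (number of odd components of `G - S` minus the order of `S`) and
has maximal order among the sets with this property. -/
structure IsMaximalBarrier (G : SimpleGraph V) (S : Set V) : Prop where
  le : ∀ X : Set V, (oddDeletionComponents G X).ncard + S.ncard ≤
    (oddDeletionComponents G S).ncard + X.ncard
  lt : ∀ X : Set V, S.ncard < X.ncard → (oddDeletionComponents G X).ncard + S.ncard <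
    (oddDeletionComponents G S).ncard + X.ncard

lemma exists_isMaximalBarrier [Finite V] (G : SimpleGraph V) : ∃ S, G.IsMaximalBarrier S := by
  obtain ⟨S, hS⟩ := Finite.exists_max fun X : Set V ↦
    (toLex (((oddDeletionComponents G X).ncard : ℤ) - X.ncard, X.ncard) : ℤ ×ₗ ℕ)
  simp only [Prod.Lex.toLex_le_toLex] at hS
  refine ⟨S, fun X ↦ ?_, fun X hX ↦ ?_⟩ <;> have := hS X <;> lia

/-- Tutte's theorem together with the parity of the number of odd components. -/
lemma exists_oddDeletionComponents_of_not_isPerfectMatching [Finite W]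
    (h : ¬ ∃ M : H.Subgraph, M.IsPerfectMatching) : ∃ Y : Set W,
      Y.ncard < (oddDeletionComponents H Y).ncard ∧
      (Odd (oddDeletionComponents H Y).ncard ↔ Odd (Nat.card W - Y.ncard)) := by
  rw [tutte] at h
  push Not at h
  obtain ⟨Y, hY⟩ := h
  let e : ((⊤ : H.Subgraph).deleteVerts Y).coe ↪g H :=
    ⟨⟨Subtype.val, Subtype.val_injective⟩, fun {a b} ↦ by
      have ha := a.2
      have hb := b.2
      simp only [Subgraph.deleteVerts_verts, Subgraph.verts_top, Set.mem_sdiff] at ha hb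
      simp [ha.2, hb.2]⟩
  have hodd : (oddDeletionComponents H Y).ncard =
      ((⊤ : H.Subgraph).deleteVerts Y).coe.oddComponents.ncard :=
    e.ncard_isDeletionComponent (X := Y) (by ext; simp [e]) Odd
  refine ⟨Y, hodd ▸ hY, ?_⟩
  rw [hodd, odd_ncard_oddComponents, Nat.card_coe_set_eq, Subgraph.deleteVerts_verts,
    Subgraph.verts_top, ← Set.compl_eq_univ_sdiff, Set.ncard_compl]

namespace IsMaximalBarrier

variable [Finite V] {S C : Set V}

lemma hypomatchable (hS : G.IsMaximalBarrier S) (hC : G.IsDeletionComponent S C) :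
    Hypomatchable (G.induce C) := by
  intro u
  by_contra hM
  obtain ⟨Y, hY, hpar⟩ := exists_oddDeletionComponents_of_not_isPerfectMatching hM
  let e : (G.induce C).induce {u}ᶜ ↪g G := (Embedding.induce C).comp (Embedding.induce {u}ᶜ)
  have huY : u.1 ∉ e '' Y := by
    rintro ⟨a, -, ha⟩
    exact a.2 (Subtype.ext ha)
  set Z : Set V := insert u.1 (e '' Y) with hZ
  have hZC : Z ⊆ C := by
    rintro v (rfl | ⟨a, -, rfl⟩)
    exacts [u.2, a.1.2]
  have hZcard : Z.ncard = Y.ncard + 1 := by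
    rw [hZ, Set.ncard_insert_of_notMem huY, Set.ncard_image_of_injective _ e.injective]
  have hodd : (oddDeletionComponents G (Z ∪ Cᶜ)).ncard =
      (oddDeletionComponents ((G.induce C).induce {u}ᶜ) Y).ncard := by
    rw [oddDeletionComponents, oddDeletionComponents,
      (e.comp (Embedding.induce Yᶜ)).ncard_isDeletionComponent (X := Z ∪ Cᶜ) ?_ Odd,
      (Embedding.induce Yᶜ).ncard_isDeletionComponent (X := Y) Subtype.range_coe Odd]
    ext v
    simp only [Set.mem_range, Set.mem_compl_iff, Set.mem_union, hZ, Set.mem_insert_iff,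
      Set.mem_image, not_or, not_not]
    constructor
    · rintro ⟨a, rfl⟩
      refine ⟨⟨fun h ↦ a.1.2 (Subtype.ext h), ?_⟩, a.1.1.2⟩
      rintro ⟨b, hb, hba⟩
      exact a.2 ((e.injective hba : b = a.1) ▸ hb)
    · rintro ⟨⟨h1, h2⟩, h3⟩
      exact ⟨⟨⟨⟨v, h3⟩, fun h ↦ h1 (congrArg Subtype.val h)⟩, fun h ↦ h2 ⟨_, h, rfl⟩⟩, rfl⟩
  have hcardW : Nat.card ({u}ᶜ : Set C) = C.ncard - 1 := by
    rw [Nat.card_coe_set_eq, Set.ncard_compl, Set.ncard_singleton, Nat.card_coe_set_eq]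
  have hYle : Y.ncard ≤ C.ncard - 1 := hcardW ▸ Set.ncard_le_card Y
  have hCpos : 0 < C.ncard := (Set.ncard_pos).2 hC.nonempty
  have hdisj : Disjoint S Z := (hC.disjoint.mono_left hZC).symm
  have hsub : (oddDeletionComponents G S \ {C}) ∪ oddDeletionComponents G (Z ∪ Cᶜ) ⊆
      oddDeletionComponents G (S ∪ Z) := by
    rintro D (⟨⟨hD, hDodd⟩, hDC⟩ | ⟨hD, hDodd⟩)
    · refine ⟨hD.congr_deleted ?_ fun a ha b hb ↦ hD.mem_of_adj a ha b (hb ∘ .inl), hDodd⟩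
      refine Set.disjoint_union_right.2 ⟨hD.disjoint, Set.disjoint_left.2 fun v hvD hvZ ↦ ?_⟩
      exact hDC (hD.eq_of_mem hC hvD (hZC hvZ))
    · refine ⟨hD.of_union_compl (fun a ha b hb ↦ hC.mem_of_adj a ha b (hb ∘ .inl)) ?_
        Set.subset_union_right, hDodd⟩
      rintro v ⟨hv | hv, hvC⟩
      exacts [(Set.disjoint_left.1 hC.disjoint hvC hv).elim, hv]
  have hdisj' : Disjoint (oddDeletionComponents G S \ {C})
      (oddDeletionComponents G (Z ∪ Cᶜ)) := by
    refine Set.disjoint_left.2 fun D hD hD' ↦ hD.2 ?_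
    obtain ⟨v, hv⟩ := hD'.1.nonempty
    exact hD.1.1.eq_of_mem hC hv (hD'.1.subset_of_union_compl hv)
  have hle := Set.ncard_le_ncard hsub
  rw [Set.ncard_union_eq hdisj', hodd] at hle
  have hScard : (S ∪ Z).ncard = S.ncard + (Y.ncard + 1) := by
    rw [Set.ncard_union_eq hdisj, hZcard]
  have hlt := hS.lt (S ∪ Z) (by lia)
  by_cases hCodd : Odd C.ncard
  · have := Set.ncard_sdiff_singleton_add_one (s := oddDeletionComponents G S) ⟨hC, hCodd⟩
    rw [hcardW] at hpar
    grind
  · rw [Set.sdiff_singleton_eq_self fun h ↦ hCodd h.2] at hle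
    lia

lemma odd_ncard (hS : G.IsMaximalBarrier S) (hC : G.IsDeletionComponent S C) :
    Odd C.ncard := by
  classical
  have := Fintype.ofFinite V
  obtain ⟨u, hu⟩ := hC.nonempty
  obtain ⟨M, hM⟩ := hS.hypomatchable hC ⟨u, hu⟩
  have heven := hM.even_card
  rw [← Nat.card_eq_fintype_card, Nat.card_coe_set_eq, Set.ncard_compl, Set.ncard_singleton,
    Nat.card_coe_set_eq] at heven
  have hCpos : 0 < C.ncard := (Set.ncard_pos).2 ⟨u, hu⟩
  grind

/-- Hall's condition for a maximal barrier in the bipartite graph of the barrier and the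
components left by it. -/
lemma ncard_le_ncard_adjacent (hS : G.IsMaximalBarrier S) {R : Set V} (hR : R ⊆ S) :
    R.ncard ≤ {C | G.IsDeletionComponent S C ∧ ∃ s ∈ R, ∃ a ∈ C, G.Adj a s}.ncard := by
  set N := {C | G.IsDeletionComponent S C ∧ ∃ s ∈ R, ∃ a ∈ C, G.Adj a s} with hN
  have hsub : oddDeletionComponents G S \ N ⊆ oddDeletionComponents G (S \ R) := by
    rintro D ⟨⟨hD, hodd⟩, hDN⟩
    refine ⟨hD.congr_deleted (hD.disjoint.mono_right Set.sdiff_subset) fun a ha b hb hab ↦ ?_, hodd⟩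
    by_cases hbS : b ∈ S
    · refine (hDN ⟨hD, b, ?_, a, ha, hab⟩).elim
      by_contra hbR
      exact hb ⟨hbS, hbR⟩
    · exact hD.mem_of_adj a ha b hbS hab
  have h1 := Set.ncard_le_ncard hsub
  have h2 := Set.le_ncard_sdiff N (oddDeletionComponents G S)
  have h3 := hS.le (S \ R)
  have h4 := Set.ncard_sdiff_add_ncard_of_subset hR
  lia

end IsMaximalBarrier

/-- `G[C]` has an `𝓕`-factor, expressed without passing to the type of vertices of `C`. -/
def HasFamilyFactorOn (𝓕 : Set (Σ W : Type, SimpleGraph W)) (G : SimpleGraph V) (C : Set V) :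
    Prop :=
  ∃ F ≤ G, (∀ a b, F.Adj a b → a ∈ C) ∧ ∀ v ∈ C, ∃ H ∈ 𝓕, ∃ φ : H.2 ↪g F,
    v ∈ Set.range φ ∧ Set.range φ ⊆ C ∧ ∀ a b, F.Adj (φ a) b → b ∈ Set.range φ

namespace HasFamilyFactorOn

variable {𝓕 : Set (Σ W : Type, SimpleGraph W)}

lemma of_isFamilyFactor {V : Type} {G : SimpleGraph V} {C : Set V} {F : SimpleGraph C}
    (hF : IsFamilyFactor 𝓕 (G.induce C) F) : HasFamilyFactorOn 𝓕 G C := by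
  refine ⟨F.map (Function.Embedding.subtype (· ∈ C)), ?_, ?_, fun v hv ↦ ?_⟩
  · rw [map_le_iff_le_comap]
    exact hF.1
  · simp only [map_adj]
    rintro _ _ ⟨a, b, -, rfl, rfl⟩
    exact a.2
  · set c := F.connectedComponentMk ⟨v, hv⟩ with hc
    obtain ⟨H, hH, ⟨ψ⟩⟩ := hF.2 c
    refine ⟨H, hH, ((Embedding.map (Function.Embedding.subtype (· ∈ C)) F).comp
      (Embedding.induce c.supp)).comp ψ.symm.toEmbedding, ?_, ?_, ?_⟩
    · exact ⟨ψ ⟨⟨v, hv⟩, rfl⟩, congrArg (fun z : c.supp ↦ z.1.1) (ψ.symm_apply_apply _)⟩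
    · rintro _ ⟨a, rfl⟩
      exact (ψ.symm a).1.2
    · intro a b hab
      obtain ⟨x, y, hxy, hx, rfl⟩ := (map_adj _ _ _ _).1 hab
      have hxa : x = (ψ.symm a).1 := Subtype.ext hx
      have hy : y ∈ c.supp := (c.mem_supp_congr_adj hxy).1 (hxa ▸ (ψ.symm a).2)
      exact ⟨ψ ⟨y, hy⟩, congrArg (fun z : c.supp ↦ z.1.1) (ψ.symm_apply_apply _)⟩

/-- A perfect matching of `G[C]` is an `𝓕`-factor when `P₂ ∈ 𝓕`. -/
lemma of_existsUnique_adj (hP2 : (⟨Fin 2, pathGraph 2⟩ : Σ W : Type, SimpleGraph W) ∈ 𝓕)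
    {C : Set V} {F : SimpleGraph V} (hle : F ≤ G) (hC : ∀ a b, F.Adj a b → a ∈ C)
    (huniq : ∀ a ∈ C, ∃! b, F.Adj a b) : HasFamilyFactorOn 𝓕 G C := by
  refine ⟨F, hle, hC, fun v hv ↦ ?_⟩
  obtain ⟨w, hvw, hw⟩ := huniq v hv
  have hw' : ∀ b, F.Adj w b → b = v := fun b hb ↦
    (huniq w (hC _ _ hvw.symm)).unique hb hvw.symm
  have hinj : Function.Injective ![v, w] := by
    intro i j
    fin_cases i <;> fin_cases j <;> simp [hvw.ne, hvw.ne']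
  let φ : pathGraph 2 ↪g F := ⟨⟨![v, w], hinj⟩, fun {i j} ↦ by
    rw [pathGraph_two_eq_top]
    fin_cases i <;> fin_cases j <;> simp [hvw, hvw.symm]⟩
  refine ⟨_, hP2, φ, ⟨0, rfl⟩, ?_, ?_⟩
  · rintro _ ⟨i, rfl⟩
    fin_cases i
    exacts [hv, hC _ _ hvw.symm]
  · intro i b hb
    fin_cases i
    · exact ⟨1, (hw b hb).symm⟩
    · exact ⟨0, (hw' b hb).symm⟩

lemma insert_of_hypomatchable
    (hP2 : (⟨Fin 2, pathGraph 2⟩ : Σ W : Type, SimpleGraph W) ∈ 𝓕) {C : Set V}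
    (hC : Hypomatchable (G.induce C)) {s a : V} (hs : s ∉ C) (ha : a ∈ C) (has : G.Adj a s) :
    HasFamilyFactorOn 𝓕 G (insert s C) := by
  obtain ⟨M, hM⟩ := hC ⟨a, ha⟩
  let e : (G.induce C).induce {⟨a, ha⟩}ᶜ ↪g G :=
    (Embedding.induce C).comp (Embedding.induce ({⟨a, ha⟩}ᶜ : Set C))
  have he : ∀ x, e x ≠ a := fun x hx ↦ x.2 (Subtype.ext hx)
  have heC : ∀ x, e x ∈ C := fun x ↦ x.1.2
  have hes : ∀ x, e x ≠ s := fun x hx ↦ hs (hx ▸ heC x)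
  have hadj : ∀ x y, (M.spanningCoe.map e.toEmbedding ⊔ edge a s).Adj x y ↔
      (∃ x' y', M.Adj x' y' ∧ e x' = x ∧ e y' = y) ∨ (x = a ∧ y = s) ∨ (x = s ∧ y = a) := by
    intro x y
    rw [sup_adj, edge_adj, map_adj]
    have := has.ne
    refine or_congr Iff.rfl ?_
    grind
  refine of_existsUnique_adj hP2 (F := M.spanningCoe.map e.toEmbedding ⊔ edge a s) ?_ ?_ ?_
  · intro x y hxy
    rw [hadj] at hxy
    rcases hxy with ⟨x', y', h, rfl, rfl⟩ | ⟨rfl, rfl⟩ | ⟨rfl, rfl⟩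
    exacts [e.map_adj_iff.2 h.adj_sub, has, has.symm]
  · intro x y hxy
    rw [hadj] at hxy
    rcases hxy with ⟨x', y', h, rfl, rfl⟩ | ⟨rfl, rfl⟩ | ⟨rfl, rfl⟩
    exacts [.inr (heC _), .inr ha, .inl rfl]
  · intro x hx
    simp only [hadj]
    by_cases hxs : x = s
    · subst hxs
      refine ⟨a, by simp, ?_⟩
      rintro y (⟨x', y', -, h, -⟩ | ⟨h, -⟩ | ⟨-, h⟩)
      exacts [(hes _ h).elim, (has.ne' h).elim, h]
    by_cases hxa : x = a
    · subst hxa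
      refine ⟨s, by simp, ?_⟩
      rintro y (⟨x', y', -, h, -⟩ | ⟨-, h⟩ | ⟨h, -⟩)
      exacts [(he _ h).elim, h, (hxs h).elim]
    have hxC : x ∈ C := hx.resolve_left hxs
    let x' : ({⟨a, ha⟩}ᶜ : Set C) := ⟨⟨x, hxC⟩, fun h ↦ hxa (congrArg Subtype.val h)⟩
    obtain ⟨y, hy, hyu⟩ := hM.1 (hM.2 x')
    refine ⟨e y, .inl ⟨x', y, hy, rfl, rfl⟩, ?_⟩
    rintro z (⟨x'', z', h, hx'', rfl⟩ | ⟨h, -⟩ | ⟨h, -⟩)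
    · obtain rfl : x'' = x' := e.injective hx''
      rw [hyu _ h]
    exacts [(hxa h).elim, (hxs h).elim]

/-- `𝓕`-factors of the parts of a partition of the vertex set combine to an `𝓕`-factor. -/
lemma exists_isFamilyFactor {V : Type} {G : SimpleGraph V} {ι : Type*} {P : ι → Set V}
    (hconn : ∀ H ∈ 𝓕, H.2.Connected) (hdisj : ∀ i j v, v ∈ P i → v ∈ P j → i = j)
    (hcover : ∀ v, ∃ i, v ∈ P i) (hP : ∀ i, HasFamilyFactorOn 𝓕 G (P i)) :
    ∃ F, IsFamilyFactor 𝓕 G F := by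
  choose F hle hF hφ using hP
  have hadj {i : ι} {a b : V} (ha : a ∈ P i) : (⨆ i, F i).Adj a b ↔ (F i).Adj a b := by
    rw [iSup_adj]
    refine ⟨fun ⟨j, hj⟩ ↦ ?_, fun h ↦ ⟨i, h⟩⟩
    rwa [hdisj i j a ha (hF j a b hj)]
  refine ⟨⨆ i, F i, iSup_le hle, fun c ↦ ?_⟩
  obtain ⟨v, hv⟩ := c.nonempty_supp
  obtain ⟨i, hi⟩ := hcover v
  obtain ⟨H, hH, φ, ⟨x, rfl⟩, hsub, hclosed⟩ := hφ i v hi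
  let ψ : H.2 ↪g ⨆ i, F i :=
    ⟨φ.toEmbedding, fun {a b} ↦ (hadj (hsub ⟨a, rfl⟩)).trans φ.map_adj_iff⟩
  have hrange : Set.range ψ = c.supp := by
    have hc := (Embedding.refl (G := ⨆ i, F i)).isDeletionComponent_image_supp (X := ∅)
      (by ext; simp) c
    rw [show (Embedding.refl (G := ⨆ i, F i)) '' c.supp = c.supp from Set.image_id _] at hc
    refine hc.eq_of_subset _ ?_ ⟨_, x, rfl⟩ ?_
    · rintro _ ⟨y, rfl⟩
      have hxy := ((hconn H hH).preconnected y x).map ψ.toHom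
      exact (ConnectedComponent.sound hxy).trans hv
    · rintro _ ⟨y, rfl⟩ b - hb
      exact hclosed y b ((hadj (hsub ⟨y, rfl⟩)).1 hb)
  have hiso : Nonempty ((⨆ i, F i).induce (Set.range ψ) ≃g H.2) :=
    ⟨Iso.symm ⟨Equiv.ofInjective ψ ψ.injective, ψ.map_adj_iff⟩⟩
  rw [hrange] at hiso
  exact ⟨H, hH, hiso⟩

end HasFamilyFactorOn

/-- In a finite bipartite graph with Hall's condition for all sets on the side `β` and for the sets
of elements of `α` not satisfying `p`, some matching covers `β` and all these elements of `α`. -/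
lemma exists_matching_covering {α β : Type*} [Fintype α] [Fintype β] (r : α → β → Prop)
    (p : α → Prop) (hβ : ∀ R : Set β, R.ncard ≤ {a | ∃ b ∈ R, r a b}.ncard)
    (hα : ∀ A : Set α, (∀ a ∈ A, ¬ p a) → A.ncard ≤ {b | ∃ a ∈ A, r a b}.ncard) :
    ∃ m : α → Option β, (∀ a b, m a = some b → r a b) ∧ (∀ a, m a = none → p a) ∧
      ∀ b, ∃! a, m a = some b := by
  classical
  have hcard : Nat.card β ≤ Nat.card α := by
    rw [← Set.ncard_univ β]
    exact (hβ Set.univ).trans (Set.ncard_le_card _)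
  let r' : α → β ⊕ Fin (Nat.card α - Nat.card β) → Prop := fun a ↦ Sum.elim (r a) fun _ ↦ p a
  obtain ⟨f, hf, hr⟩ := (Fintype.all_card_le_filter_rel_iff_exists_injective r').1 fun A ↦ by
    rw [← Set.ncard_coe_finset, ← Set.ncard_coe_finset, Finset.coe_filter_univ]
    by_cases hA : ∀ a ∈ A, ¬ p a
    · refine (hα A hA).trans ?_
      rw [← Set.ncard_image_of_injective _ (Sum.inl_injective (β := Fin _))]
      refine Set.ncard_le_ncard ?_
      rintro _ ⟨b, hb, rfl⟩
      exact hb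
    · push Not at hA
      obtain ⟨a, ha, hpa⟩ := hA
      set N := {b | ∃ a ∈ (A : Set α), r a b} with hN
      have h1 : {b | ∃ a ∈ A, r' a b} ⊇ Sum.inl '' N ∪ Sum.inr '' Set.univ := by
        rintro _ (⟨b, hb, rfl⟩ | ⟨i, -, rfl⟩)
        exacts [hb, ⟨a, ha, hpa⟩]
      refine le_trans ?_ (Set.ncard_le_ncard h1)
      rw [Set.ncard_union_eq (by simp [Set.disjoint_left]),
        Set.ncard_image_of_injective _ Sum.inl_injective,
        Set.ncard_image_of_injective _ Sum.inr_injective, Set.ncard_univ, Nat.card_fin]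
      have h2 : {a | ∃ b ∈ Nᶜ, r a b} ⊆ (A : Set α)ᶜ := by
        rintro a' ⟨b, hb, hab⟩ ha'
        exact hb ⟨a', ha', hab⟩
      have h3 := (hβ Nᶜ).trans (Set.ncard_le_ncard h2)
      have h4 := Set.ncard_add_ncard_compl (A : Set α)
      have h5 := Set.ncard_add_ncard_compl N
      lia
  have hsurj : Function.Surjective f := by
    refine ((Fintype.bijective_iff_injective_and_card f).2 ⟨hf, ?_⟩).2
    rw [← Nat.card_eq_fintype_card, ← Nat.card_eq_fintype_card, Nat.card_sum, Nat.card_fin]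
    lia
  refine ⟨fun a ↦ (f a).getLeft?, fun a b hab ↦ ?_, fun a ha ↦ ?_, fun b ↦ ?_⟩
  · have := hr a
    rwa [Sum.getLeft?_eq_some_iff.1 hab] at this
  · have := hr a
    obtain ⟨i, hi⟩ := Sum.isRight_iff.1 (Sum.getLeft?_eq_none_iff.1 ha)
    rwa [hi] at this
  · obtain ⟨a, ha⟩ := hsurj (.inl b)
    refine ⟨a, Sum.getLeft?_eq_some_iff.2 ha, fun a' ha' ↦ hf ?_⟩
    rw [ha, Sum.getLeft?_eq_some_iff.1 ha']

section GoodPair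

variable {k : ℕ} {𝓕 : Set (Σ W : Type, SimpleGraph W)} {ε : ℝ} {lam : ℕ} {V : Type} [Finite V]
  {G : SimpleGraph V} {S C : Set V}

lemma IsMaximalBarrier.exists_smallOddComponents (hS : G.IsMaximalBarrier S)
    (hgood : IsGoodPair k 𝓕 ε lam) (hε : ε ≤ 1) (hC : G.IsDeletionComponent S C)
    (hCF : ¬ HasFamilyFactorOn 𝓕 G C) :
    ∃ x ⊆ C, (lam * ε / (lam + 1) : ℝ) * (1 + x.ncard) ≤
      (smallOddComponents k G (x ∪ Cᶜ)).ncard := by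
  have hlam : (0 : ℝ) < lam + 1 := by positivity
  have := hgood.1
  by_cases hk : C.ncard < 2 * k
  · refine ⟨∅, Set.empty_subset C, ?_⟩
    have hmem : C ∈ smallOddComponents k G (∅ ∪ Cᶜ) := by
      refine ⟨hC.congr_deleted ?_ fun _ _ b hb _ ↦ ?_, hS.odd_ncard hC, hk⟩
      · rw [Set.empty_union]
        exact disjoint_compl_right
      · simpa using hb
    have hpos : 1 ≤ (smallOddComponents k G (∅ ∪ Cᶜ)).ncard := (Set.ncard_pos).2 ⟨C, hmem⟩
    calc (lam * ε / (lam + 1) : ℝ) * (1 + (∅ : Set V).ncard) ≤ 1 := by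
          rw [Set.ncard_empty, Nat.cast_zero, add_zero, mul_one, div_le_one hlam]
          nlinarith [(Nat.cast_nonneg lam : (0 : ℝ) ≤ lam)]
      _ ≤ _ := by exact_mod_cast hpos
  · obtain ⟨j, hj⟩ := hS.odd_ncard hC
    obtain ⟨X, hX, hsum⟩ := hgood.2 C (Fintype.ofFinite C) (G.induce C) (hS.hypomatchable hC)
      (by rw [Nat.card_coe_set_eq]; lia)
      fun ⟨F, hF⟩ ↦ hCF (HasFamilyFactorOn.of_isFamilyFactor hF)
    refine ⟨Subtype.val '' X, by simp, ?_⟩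
    rw [(Embedding.induce C).ncard_smallOddComponents (Y := X) k ?_,
      Set.ncard_image_of_injective _ Subtype.val_injective]
    · push_cast
      refine le_trans ?_ hsum
      rw [Nat.card_coe_set_eq] at hX ⊢
      have hX' : (lam : ℝ) ≤ X.ncard := by exact_mod_cast hX
      rw [div_mul_eq_mul_div, div_le_iff₀ hlam]
      nlinarith
    · ext v
      by_cases hv : v ∈ C <;> simp [hv]

lemma IsMaximalBarrier.ncard_le_ncard_of_not_hasFamilyFactorOn (hS : G.IsMaximalBarrier S)
    (hgood : IsGoodPair k 𝓕 ε lam) (hε : ε ≤ 1) (hlam : 0 < lam)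
    (h : ∀ X : Set V, (∑ j ∈ Finset.range k, (cComp G X (2 * j + 1) : ℝ)) ≤
      (lam * ε / (lam + 1) : ℝ) * Nat.card X)
    (A : Set {C // G.IsDeletionComponent S C}) (hA : ∀ C ∈ A, ¬ HasFamilyFactorOn 𝓕 G C.1) :
    A.ncard ≤ {s : S | ∃ C ∈ A, ∃ a ∈ C.1, G.Adj a s}.ncard := by
  classical
  have hx (C : {C // G.IsDeletionComponent S C}) (hC : C ∈ A) :=
    hS.exists_smallOddComponents hgood hε C.2 (hA C hC)
  choose! x hxC hx using hx
  set N := {s : S | ∃ C ∈ A, ∃ a ∈ C.1, G.Adj a s} with hN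
  let X : Set V := Subtype.val '' N ∪ ⋃ C ∈ A.toFinite.toFinset, x C
  have hNX : ∀ s : S, s ∈ N → s.1 ∈ X := fun s hs ↦ .inl ⟨s, hs, rfl⟩
  have hxX : ∀ C ∈ A, x C ⊆ X := fun C hC v hv ↦ .inr (Set.mem_biUnion (by simpa using hC) hv)
  have hXcard : X.ncard ≤ N.ncard + ∑ C ∈ A.toFinite.toFinset, (x C).ncard := by
    refine (Set.ncard_union_le _ _).trans (add_le_add ?_ (Finset.set_ncard_biUnion_le _ _))
    rw [Set.ncard_image_of_injective _ Subtype.val_injective]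
  have hsub : ∀ C ∈ A, smallOddComponents k G (x C ∪ C.1ᶜ) ⊆ smallOddComponents k G X := by
    intro C hC D hD
    refine ⟨hD.1.of_union_compl (fun a ha b hb hab ↦ ?_) ?_ (hxX C hC), hD.2⟩
    · exact C.2.mem_of_adj a ha b (fun hbS ↦ hb (hNX ⟨b, hbS⟩ ⟨C, hC, a, ha, hab⟩)) hab
    · rintro v ⟨⟨s, -, rfl⟩ | hv, hvC⟩
      · exact (Set.disjoint_left.1 C.2.disjoint hvC s.2).elim
      · simp only [Set.mem_iUnion, Set.Finite.mem_toFinset] at hv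
        obtain ⟨D, hDA, hv⟩ := hv
        rwa [Subtype.ext (C.2.eq_of_mem D.2 hvC (hxC D hDA hv))]
  have hsum : ∑ C ∈ A.toFinite.toFinset, (smallOddComponents k G (x C ∪ C.1ᶜ)).ncard ≤
      (smallOddComponents k G X).ncard := by
    simp_rw [fun s : Set (Set V) ↦ Set.ncard_eq_toFinset_card s s.toFinite]
    rw [← Finset.card_biUnion]
    · refine Finset.card_le_card (Finset.biUnion_subset.2 fun C hC ↦ ?_)
      exact Set.Finite.toFinset_subset_toFinset.2 (hsub C (by simpa using hC))
    · intro C _ C' _ hne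
      refine Finset.disjoint_left.2 fun D hD hD' ↦ hne (Subtype.ext ?_)
      simp only [Set.Finite.mem_toFinset] at hD hD'
      obtain ⟨v, hv⟩ := hD.1.nonempty
      exact C.2.eq_of_mem C'.2 (hD.1.subset_of_union_compl hv) (hD'.1.subset_of_union_compl hv)
  have hX := h X
  rw [Nat.card_coe_set_eq] at hX
  have hcard := (Embedding.refl (G := G)).ncard_smallOddComponents (X := X) (Y := X) k (by simp)
  set c : ℝ := lam * ε / (lam + 1) with hc
  have hcpos : 0 < c := by
    have := hgood.1
    positivity
  have hlower : c * (A.ncard + ∑ C ∈ A.toFinite.toFinset, ((x C).ncard : ℝ)) ≤ c * X.ncard := by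
    calc c * (A.ncard + ∑ C ∈ A.toFinite.toFinset, ((x C).ncard : ℝ))
        = ∑ C ∈ A.toFinite.toFinset, c * (1 + (x C).ncard) := by
          rw [← Finset.mul_sum, Finset.sum_add_distrib, Finset.sum_const, nsmul_one,
            Set.ncard_eq_toFinset_card A A.toFinite]
      _ ≤ ∑ C ∈ A.toFinite.toFinset, ((smallOddComponents k G (x C ∪ C.1ᶜ)).ncard : ℝ) :=
          Finset.sum_le_sum fun C hC ↦ hx C (by simpa using hC)
      _ ≤ (smallOddComponents k G X).ncard := by exact_mod_cast hsum
      _ ≤ c * X.ncard := by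
          rw [hcard]
          exact_mod_cast hX
  have hlower' := le_of_mul_le_mul_left hlower hcpos
  have : A.ncard + ∑ C ∈ A.toFinite.toFinset, (x C).ncard ≤ X.ncard := by exact_mod_cast hlower'
  lia

end GoodPair

end SimpleGraph

/-- Let `k ≥ 1`, let `𝓕` be a set of connected graphs with `P₂ ∈ 𝓕`, and let `(ε, λ)` be a
`(k, 𝓕)`-good pair with `ε ≤ 1`.  If `G` satisfies
`∑_{0 ≤ j ≤ k-1} c_{2j+1}(G - X) ≤ (λε/(λ+1))·|X|` for all `X ⊆ V(G)`, then `G` has an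
`𝓕`-factor. -/
theorem stmt4 (k : ℕ) (hk : 1 ≤ k) (𝓕 : Set (Σ W : Type, SimpleGraph W))
    (hconn : ∀ H ∈ 𝓕, H.2.Connected)
    (hP2 : (⟨Fin 2, pathGraph 2⟩ : Σ W : Type, SimpleGraph W) ∈ 𝓕)
    (ε : ℝ) (lam : ℕ) (hgood : IsGoodPair k 𝓕 ε lam) (hε : ε ≤ 1)
    {V : Type} [Fintype V] (G : SimpleGraph V)
    (h : ∀ X : Set V, (∑ j ∈ Finset.range k, (cComp G X (2 * j + 1) : ℝ)) ≤
      ((lam : ℝ) * ε / ((lam : ℝ) + 1)) * Nat.card X) :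
    ∃ F, IsFamilyFactor 𝓕 G F := by
  classical
  rcases Nat.eq_zero_or_pos lam with rfl | hlam
  · have hV : IsEmpty V := by
      refine ⟨fun v ↦ ?_⟩
      have hX := h {v}ᶜ
      rw [Nat.cast_zero, zero_mul, zero_div, zero_mul] at hX
      have hcard := (Embedding.refl (G := G)).ncard_smallOddComponents (X := {v}ᶜ) (Y := {v}ᶜ) k
        (by simp)
      obtain ⟨D, hD, hvD⟩ := G.exists_isDeletionComponent_mem (X := {v}ᶜ) (v := v) (by simp)
      have hDv : D = {v} := by
        refine Set.Subset.antisymm (fun w hw ↦ ?_) (by simpa using hvD)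
        by_contra h
        exact Set.disjoint_left.1 hD.disjoint hw h
      have hmem : D ∈ smallOddComponents k G {v}ᶜ :=
        ⟨hD, by simp [hDv], by rw [hDv, Set.ncard_singleton]; lia⟩
      have hpos := (Set.ncard_pos).2 ⟨D, hmem⟩
      rw [hcard] at hpos
      exact hX.not_gt (by exact_mod_cast hpos)
    exact HasFamilyFactorOn.exists_isFamilyFactor (P := fun i : Empty ↦ i.elim) hconn
      (fun i ↦ i.elim) (fun v ↦ hV.elim v) fun i ↦ i.elim
  obtain ⟨S, hS⟩ := G.exists_isMaximalBarrier
  have : Fintype S := Fintype.ofFinite S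
  have : Fintype {C // G.IsDeletionComponent S C} := Fintype.ofFinite _
  obtain ⟨m, hm, hm', hmS⟩ := exists_matching_covering
    (fun (C : {C // G.IsDeletionComponent S C}) (s : S) ↦ ∃ a ∈ C.1, G.Adj a s)
    (fun C ↦ HasFamilyFactorOn 𝓕 G C.1) (fun R ↦ by
      rw [← Set.ncard_image_of_injective R Subtype.val_injective,
        ← Set.ncard_image_of_injective {C | _} Subtype.val_injective]
      refine (hS.ncard_le_ncard_adjacent (by simp)).trans (Set.ncard_le_ncard ?_)
      rintro C ⟨hC, _, ⟨s, hs, rfl⟩, hadj⟩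
      exact ⟨⟨C, hC⟩, ⟨s, hs, hadj⟩, rfl⟩)
    (hS.ncard_le_ncard_of_not_hasFamilyFactorOn hgood hε hlam h)
  refine HasFamilyFactorOn.exists_isFamilyFactor
    (P := fun C ↦ C.1 ∪ {s | ∃ t : S, t.1 = s ∧ m C = some t}) hconn ?_ ?_ ?_
  · rintro C D v (hC | ⟨t, rfl, hC⟩) (hD | ⟨t', ht', hD⟩)
    · exact Subtype.ext (C.2.eq_of_mem D.2 hC hD)
    · exact (Set.disjoint_left.1 C.2.disjoint hC (ht' ▸ t'.2)).elim
    · exact (Set.disjoint_left.1 D.2.disjoint hD t.2).elim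
    · obtain rfl := Subtype.ext ht'
      exact (hmS t').unique hC hD
  · intro v
    by_cases hv : v ∈ S
    · obtain ⟨C, hC, -⟩ := hmS ⟨v, hv⟩
      exact ⟨C, .inr ⟨_, rfl, hC⟩⟩
    · obtain ⟨D, hD, hvD⟩ := G.exists_isDeletionComponent_mem hv
      exact ⟨⟨D, hD⟩, .inl hvD⟩
  · intro C
    cases hmC : m C with
    | none => simpa [hmC] using hm' C hmC
    | some s =>
      obtain ⟨a, ha, has⟩ := hm C s hmC
      convert HasFamilyFactorOn.insert_of_hypomatchable hP2 (hS.hypomatchable C.2)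
        (fun hs ↦ Set.disjoint_left.1 C.2.disjoint hs s.2) ha has using 1
      ext v
      simp only [Option.some_inj, exists_eq_right', Set.mem_union, Set.mem_ofPred_eq,
        Set.mem_insert_iff]
      grind
end
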